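/- arXiv:1701.08115 — 3 statements merged into one kernel-verified Lean document; each statement's English description precedes it below -/
import Mathlib

section
/- For all integers 2 ≤ k ≤ s with s ≡ 0 (mod k), there exist n₀ ∈ ℕ and c > 0 (depending only on k and s) such that for all n ≥ n₀: every k-graph H on n vertices that does not have a C_s^k-covering satisfies δ_{k−1}(H) ≤ c·n^{1−(k/s)^{k−1}}. (In other words, c_{k−1}(n, C_s^k) ≤ c·n^{1−(k/s)^{k−1}}.) -/
set_option autoImplicit false

open Finset

section Defs

variable {V : Type} [Fintype V] [DecidableEq V]

/-- `E` is the edge set of a `k`-uniform hypergraph on `V`. -/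
def IsKGraph (k : ℕ) (E : Finset (Finset V)) : Prop := ∀ e ∈ E, e.card = k

/-- The degree of a vertex set `S`: the number of edges containing `S`. -/
def degS (E : Finset (Finset V)) (S : Finset V) : ℕ := (E.filter fun e => S ⊆ e).card

/-- `C` is the (cyclically ordered) vertex list of a copy of a tight cycle:
the vertices are distinct and every `k` cyclically consecutive vertices form an edge. -/
def IsTightCycleList (k : ℕ) (E : Finset (Finset V)) (C : List V) : Prop :=
  C.Nodup ∧ ∀ i < C.length, (((C ++ C).drop i).take k).toFinset ∈ E

/-- `H` has a `C_s^k`-covering: every vertex lies in a copy of the tight cycle on `s` vertices. -/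
def HasCsCovering (k s : ℕ) (E : Finset (Finset V)) : Prop :=
  ∀ v : V, ∃ C : List V, C.length = s ∧ IsTightCycleList k E C ∧ v ∈ C

/-- `H` contains a copy of `C_s^k`. -/
def HasCsCopy (k s : ℕ) (E : Finset (Finset V)) : Prop :=
  ∃ C : List V, C.length = s ∧ IsTightCycleList k E C

/-- `A` is the vertex set of a copy of `C_s^k` in `H`. -/
def SpansCs (k s : ℕ) (E : Finset (Finset V)) (A : Finset V) : Prop :=
  ∃ C : List V, C.length = s ∧ IsTightCycleList k E C ∧ C.toFinset = A

/-- a `C_s^k`-tiling: a set of pairwise disjoint vertex sets of copies of `C_s^k`. -/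
def IsCsTiling (k s : ℕ) (E : Finset (Finset V)) (T : Finset (Finset V)) : Prop :=
  (T : Set (Finset V)).PairwiseDisjoint id ∧ ∀ A ∈ T, SpansCs k s E A

/-- a perfect `C_s^k`-tiling of the induced subgraph on `U`. -/
def HasPerfectCsTilingOn (k s : ℕ) (E : Finset (Finset V)) (U : Finset V) : Prop :=
  ∃ T : Finset (Finset V), IsCsTiling k s E T ∧ T.biUnion id = U

/-- a perfect `C_s^k`-tiling of `H`. -/
def HasPerfectCsTiling (k s : ℕ) (E : Finset (Finset V)) : Prop :=
  HasPerfectCsTilingOn k s E Finset.univ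

/-- the pair `(k,s)` is admissible if `gcd k s = 1` or `k / gcd k s` is even. -/
def AdmissiblePair (k s : ℕ) : Prop := Nat.gcd k s = 1 ∨ Even (k / Nat.gcd k s)

/-- The `k`-graph `H₀^k(A,B)`: edges are the `k`-subsets `e` of `A ∪ B`
with `|e ∩ A| ≢ k (mod 2)`. -/
def H0edges (k : ℕ) (A B : Finset V) : Finset (Finset V) :=
  ((A ∪ B).powersetCard k).filter fun e => ¬ (e ∩ A).card % 2 = k % 2

/-- `P` is (the vertex list of) a tight path: distinct vertices, every `k`
consecutive vertices form an edge. -/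
def IsTightPath (k : ℕ) (E : Finset (Finset V)) (P : List V) : Prop :=
  P.Nodup ∧ ∀ i, i + k ≤ P.length → ((P.drop i).take k).toFinset ∈ E

/-- `P = v₁ ⋯ v_ℓ` has start of type `σ` w.r.t. classes `Vc`: `v_i ∈ V_{σ(i)}`
for `1 ≤ i ≤ k-1` (0-indexed below). -/
def hasStartType (k : ℕ) (Vc : Fin k → Finset V) (P : List V) (σ : Equiv.Perm (Fin k)) : Prop :=
  k ≤ P.length + 1 ∧ ∀ j : Fin k, (j : ℕ) + 1 < k → ∀ v ∈ P[(j : ℕ)]?, v ∈ Vc (σ j)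

/-- `P = v₁ ⋯ v_ℓ` has end of type `σ` w.r.t. classes `Vc`: `v_{ℓ-k+i} ∈ V_{σ(i)}`
for `2 ≤ i ≤ k` (0-indexed below). -/
def hasEndType (k : ℕ) (Vc : Fin k → Finset V) (P : List V) (σ : Equiv.Perm (Fin k)) : Prop :=
  k ≤ P.length + 1 ∧ ∀ j : Fin k, (j : ℕ) ≠ 0 →
    ∀ v ∈ P[(P.length + (j : ℕ) - k)]?, v ∈ Vc (σ j)

/-- `Vc` are the classes of a complete `(k,k)`-graph in `H`: nonempty, pairwise disjoint,
and every transversal is an edge. -/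
def IsCompletePartite (k : ℕ) (E : Finset (Finset V)) (Vc : Fin k → Finset V) : Prop :=
  (∀ i, (Vc i).Nonempty) ∧ (∀ i j, i ≠ j → Disjoint (Vc i) (Vc j)) ∧
  ∀ g : Fin k → V, (∀ i, g i ∈ Vc i) → Finset.image g Finset.univ ∈ E

/-- the cyclic permutation `τ = (1 2 ⋯ k)` (0-indexed: `j ↦ j + 1 mod k`). -/
def cyc (k : ℕ) : Equiv.Perm (Fin k) := finRotate k

/-- `W` is a `G`-gadget for the complete `(k,k)`-graph with classes `Vc` avoiding `S`. -/
def IsGadget (k : ℕ) (E : Finset (Finset V)) (Vc : Fin k → Finset V)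
    (G : SimpleGraph (Fin k)) (S : Finset V) (W : Fin k → Fin k → Finset V) : Prop :=
  (∀ i j, G.Adj i j → W i j = W j i) ∧
  (∀ i j, G.Adj i j →
    (W i j).card = 2 * k - 1 ∧
    (W i j \ Finset.univ.biUnion Vc).card = 1 ∧
    Disjoint (W i j) S ∧
    (∀ i' : Fin k, (W i j ∩ Vc i').card = if i' = i ∨ i' = j then 1 else 2) ∧
    (∀ σ : Equiv.Perm (Fin k), (∃ z : Fin k, (z : ℕ) = 0 ∧ (σ z = i ∨ σ z = j)) →
      ∃ Q : List V, IsTightPath k E Q ∧ Q.toFinset = W i j ∧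
        hasStartType k Vc Q (σ * cyc k) ∧ hasEndType k Vc Q (Equiv.swap i j * σ))) ∧
  (∀ i j i' j', G.Adj i j → G.Adj i' j' → ({i, j} : Finset (Fin k)) ≠ {i', j'} →
    Disjoint (W i j) (W i' j'))

open Classical in
/-- the set of vertices `w_{ij}`, `ij ∈ E(G)`, of a gadget `W`. -/
noncomputable def gadgetVerts (k : ℕ) (Vc : Fin k → Finset V)
    (G : SimpleGraph (Fin k)) (W : Fin k → Fin k → Finset V) : Finset V :=
  (Finset.univ.filter fun p : Fin k × Fin k => G.Adj p.1 p.2).biUnion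
    fun p => W p.1 p.2 \ Finset.univ.biUnion Vc

/-- the graph on `[k]` consisting of the paths given by the lists in `L`. -/
def pathsGraph (k : ℕ) (L : List (List (Fin k))) : SimpleGraph (Fin k) :=
  SimpleGraph.fromEdgeSet {e | ∃ l ∈ L, ∃ p ∈ l.zip l.tail, e = s(p.1, p.2)}

/-- `G` is a vertex-disjoint union of paths. -/
def IsUnionOfPaths (k : ℕ) (G : SimpleGraph (Fin k)) : Prop :=
  ∃ L : List (List (Fin k)), (∀ l ∈ L, l.Nodup) ∧
    L.Pairwise (fun l₁ l₂ => ∀ a ∈ l₁, ∀ b ∈ l₂, a ≠ b) ∧ G = pathsGraph k L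

/-- `m(σ)` (1-indexed), read off from the normalized cycle decomposition `L` of `σ`:
the last element of the last cycle, or `1` if `L` is empty. -/
def mOf (k : ℕ) (L : List (List (Fin k))) : ℕ :=
  ((L.getLast?.bind List.getLast?).map (fun x => (x : ℕ) + 1)).getD 1

/-- `L` is the normalized cycle decomposition of `σ`: disjoint cycles of length ≥ 2,
each cycle listed ending with its minimal element, the cycles ordered by increasing
last elements. -/
def IsNormCycleDecomp (k : ℕ) (σ : Equiv.Perm (Fin k)) (L : List (List (Fin k))) : Prop :=
  (∀ l ∈ L, 2 ≤ l.length ∧ l.Nodup) ∧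
  L.Pairwise (fun l₁ l₂ => ∀ a ∈ l₁, ∀ b ∈ l₂, a ≠ b) ∧
  σ = (L.map List.formPerm).prod ∧
  (∀ l ∈ L, ∀ a ∈ l.getLast?, ∀ b ∈ l, a ≤ b) ∧
  L.Pairwise (fun l₁ l₂ => ∀ a ∈ l₁.getLast?, ∀ b ∈ l₂.getLast?, a < b)

/-- `H` is `(μ, θ)`-dense. -/
def IsDense (k : ℕ) (μ θ : ℝ) (E : Finset (Finset V)) : Prop :=
  ∃ 𝒮 : Finset (Finset V), (∀ S ∈ 𝒮, S.card = k - 1) ∧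
    (𝒮.card : ℝ) ≤ θ * ((Fintype.card V).choose (k - 1)) ∧
    ∀ S : Finset V, S.card = k - 1 → S ∉ 𝒮 →
      μ * ((Fintype.card V : ℝ) - k + 1) ≤ (degS E S : ℝ)

/-- `H` is strongly `(μ, θ)`-dense. -/
def IsStronglyDense (k : ℕ) (μ θ : ℝ) (E : Finset (Finset V)) : Prop :=
  IsDense k μ θ E ∧ ∀ e ∈ E, ∀ X ⊆ e, X.card = k - 1 →
    μ * ((Fintype.card V : ℝ) - k + 1) ≤ (degS E X : ℝ)

/-- the vertex set of `F(K,G)` inside the ambient type: all core vertices, plus one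
pendant vertex for each edge of `G`. -/
def FsVertexSet (k : ℕ) (a : Fin k → ℕ) (G : SimpleGraph (Fin k)) :
    Set ((Σ i : Fin k, Fin (a i)) ⊕ Sym2 (Fin k)) :=
  Set.range Sum.inl ∪ Sum.inr '' G.edgeSet

/-- the edges of `F(K,G)`, where `K = K^k(a)`: all transversals of the classes, plus,
for each edge `ij` of `G`, all `k`-sets consisting of the pendant vertex `w_{ij}` and one
vertex from each class other than `i` (resp. other than `j`). -/
def FKGedges (k : ℕ) (a : Fin k → ℕ) (G : SimpleGraph (Fin k)) :
    Set (Finset ((Σ i : Fin k, Fin (a i)) ⊕ Sym2 (Fin k))) :=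
  {e | (∃ g : ∀ i, Fin (a i), e = Finset.univ.image fun i => Sum.inl ⟨i, g i⟩) ∨
    (∃ i j, G.Adj i j ∧ ∃ g : ∀ i', Fin (a i'),
      e = insert (Sum.inr s(i, j)) ((Finset.univ.erase i).image fun i' => Sum.inl ⟨i', g i'⟩))}

/-- `F(K^k(a), G)` contains a spanning copy of the tight cycle `C_s^k`. -/
def FsHasSpanningCs (k s : ℕ) (a : Fin k → ℕ) (G : SimpleGraph (Fin k)) : Prop :=
  ∃ C : List ((Σ i : Fin k, Fin (a i)) ⊕ Sym2 (Fin k)),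
    C.Nodup ∧ C.length = s ∧ (↑C.toFinset : Set _) = FsVertexSet k a G ∧
    ∀ i < C.length, (((C ++ C).drop i).take k).toFinset ∈ FKGedges k a G

/-- `A` is the vertex set of a copy of `K^k(t)` in `H`. -/
def SpansEsCopy (k t : ℕ) (E : Finset (Finset V)) (A : Finset V) : Prop :=
  ∃ f : Fin k × Fin t → V, Function.Injective f ∧ Finset.univ.image f = A ∧
    ∀ g : Fin k → Fin t, (Finset.univ.image fun i => f (i, g i)) ∈ E

/-- `A` is the vertex set of a copy of `F_s = F(K^k(a), G)` in `H`. -/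
def SpansFsCopy (k : ℕ) (a : Fin k → ℕ) (G : SimpleGraph (Fin k))
    (E : Finset (Finset V)) (A : Finset V) : Prop :=
  ∃ f : ((Σ i : Fin k, Fin (a i)) ⊕ Sym2 (Fin k)) → V,
    Set.InjOn f (FsVertexSet k a G) ∧ f '' FsVertexSet k a G = ↑A ∧
    ∀ e ∈ FKGedges k a G, e.image f ∈ E

/-- `(TF, TE)` is an `{F_s, E_s}`-tiling of `H`, given as the families of vertex sets of
the copies of `F_s` and of `E_s = K^k(max_i a_i)`. -/
def IsFETiling (k : ℕ) (a : Fin k → ℕ) (G : SimpleGraph (Fin k))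
    (E : Finset (Finset V)) (TF TE : Finset (Finset V)) : Prop :=
  ((↑(TF ∪ TE) : Set (Finset V)).PairwiseDisjoint id) ∧
  (∀ A ∈ TF, SpansFsCopy k a G E A) ∧
  (∀ A ∈ TE, SpansEsCopy k (Finset.univ.sup a) E A)

/-- `φ(𝒯) = (n - s(|ℱ_𝒯| + (3/5)|ℰ_𝒯|))/n`. -/
noncomputable def phiTiling (s : ℕ) (TF TE : Finset (Finset V)) : ℝ :=
  ((Fintype.card V : ℝ) - s * ((TF.card : ℝ) + (3 / 5) * (TE.card : ℝ))) / (Fintype.card V : ℝ)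

/-- `φ(H)`: the minimum of `φ(𝒯)` over all `{F_s, E_s}`-tilings of `H`. -/
noncomputable def phiMin (k s : ℕ) (a : Fin k → ℕ) (G : SimpleGraph (Fin k))
    (E : Finset (Finset V)) : ℝ :=
  sInf {x | ∃ TF TE : Finset (Finset V), IsFETiling k a G E TF TE ∧ x = phiTiling s TF TE}

/-- `Φ(n, μ, θ)`: the maximum of `φ(H)` over all `(μ,θ)`-dense `k`-graphs `H` on `n` vertices. -/
noncomputable def PhiMax (k s : ℕ) (a : Fin k → ℕ) (G : SimpleGraph (Fin k))
    (n : ℕ) (μ θ : ℝ) : ℝ :=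
  sSup {x | ∃ E : Finset (Finset (Fin n)), IsKGraph k E ∧ IsDense k μ θ E ∧
    x = phiMin k s a G E}

end Defs

theorem mul_pow_le_mul_descFactorial_add (n d m : ℕ) (hd : d ≤ n) :
    n * d ^ m ≤ n * d.descFactorial m + m ^ 2 * n ^ m := by
  induction m with
  | zero => simp
  | succ m ih =>
    have h1 : d.descFactorial m ≤ n ^ m :=
      (Nat.descFactorial_le_pow d m).trans (Nat.pow_le_pow_left hd m)
    have h2 : d ≤ (d - m) + m := by omega
    calc n * d ^ (m + 1) = d * (n * d ^ m) := by ring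
      _ ≤ d * (n * d.descFactorial m + m ^ 2 * n ^ m) := Nat.mul_le_mul_left _ ih
      _ = d * (n * d.descFactorial m) + d * (m ^ 2 * n ^ m) := by ring
      _ ≤ ((d - m) + m) * (n * d.descFactorial m) + n * (m ^ 2 * n ^ m) := by gcongr
      _ = n * ((d - m) * d.descFactorial m) + m * n * d.descFactorial m
          + m ^ 2 * n ^ (m + 1) := by ring
      _ ≤ n * ((d - m) * d.descFactorial m) + m * n * n ^ m + m ^ 2 * n ^ (m + 1) := by gcongr
      _ ≤ n * d.descFactorial (m + 1) + (m + 1) ^ 2 * n ^ (m + 1) := by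
        rw [Nat.descFactorial_succ]
        nlinarith [Nat.zero_le (n ^ (m + 1)), Nat.zero_le (m * n ^ (m+1)), pow_succ n m]

/-- Some `m`-set of heads has many common tails. -/
theorem exists_subset_common {α β : Type} [Fintype α] [DecidableEq α]
    (Y : Finset β) (N : β → Finset α) (m : ℕ) (hm : m ≤ Fintype.card α) :
    ∃ T : Finset α, T.card = m ∧
      Fintype.card α * ∑ y ∈ Y, (N y).card ^ m ≤
        Fintype.card α ^ (m + 1) * (Y.filter fun y => T ⊆ N y).card
          + m ^ 2 * Fintype.card α ^ m * Y.card := by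
  set n := Fintype.card α with hn
  have hne : (powersetCard m (univ : Finset α)).Nonempty :=
    powersetCard_nonempty.2 (by simpa using hm)
  obtain ⟨T, hT, hmax⟩ := exists_max_image (powersetCard m (univ : Finset α))
    (fun T => (Y.filter fun y => T ⊆ N y).card) hne
  refine ⟨T, (mem_powersetCard.1 hT).2, ?_⟩
  have hcount : ∑ y ∈ Y, (N y).card.choose m =
      ∑ T ∈ powersetCard m (univ : Finset α), (Y.filter fun y => T ⊆ N y).card := by
    have := sum_card_bipartiteAbove_eq_sum_card_bipartiteBelow (s := Y)
      (t := powersetCard m (univ : Finset α)) (fun y T => T ⊆ N y)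
    refine Eq.trans ?_ this
    refine sum_congr rfl fun y _ => ?_
    rw [← card_powersetCard]
    congr 1
    ext S
    simp [bipartiteAbove, mem_powersetCard, and_comm]
  have hle : ∑ y ∈ Y, (N y).card.choose m ≤ n.choose m * (Y.filter fun y => T ⊆ N y).card := by
    rw [hcount]
    refine (sum_le_card_nsmul _ _ _ hmax).trans ?_
    simp [hn]
  have hdesc : ∑ y ∈ Y, (N y).card.descFactorial m ≤
      n ^ m * (Y.filter fun y => T ⊆ N y).card := by
    calc ∑ y ∈ Y, (N y).card.descFactorial m
        = m.factorial * ∑ y ∈ Y, (N y).card.choose m := by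
          rw [mul_sum]
          exact sum_congr rfl fun y _ => Nat.descFactorial_eq_factorial_mul_choose _ _
      _ ≤ m.factorial * (n.choose m * (Y.filter fun y => T ⊆ N y).card) := by gcongr
      _ = n.descFactorial m * (Y.filter fun y => T ⊆ N y).card := by
          rw [Nat.descFactorial_eq_factorial_mul_choose, mul_assoc]
      _ ≤ _ := by gcongr; exact Nat.descFactorial_le_pow _ _
  calc n * ∑ y ∈ Y, (N y).card ^ m = ∑ y ∈ Y, n * (N y).card ^ m := mul_sum _ _ _
    _ ≤ ∑ y ∈ Y, (n * (N y).card.descFactorial m + m ^ 2 * n ^ m) :=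
        sum_le_sum fun y _ => mul_pow_le_mul_descFactorial_add _ _ _ (card_le_univ _)
    _ = n * ∑ y ∈ Y, (N y).card.descFactorial m + m ^ 2 * n ^ m * Y.card := by
        rw [sum_add_distrib, mul_sum, sum_const, smul_eq_mul]; ring
    _ ≤ n * (n ^ m * (Y.filter fun y => T ⊆ N y).card) + m ^ 2 * n ^ m * Y.card := by gcongr
    _ = _ := by ring

theorem card_eq_sum_card_cons {V : Type} [Fintype V] [DecidableEq V] {r : ℕ}
    (A : Finset (Fin (r + 1) → V)) :
    A.card = ∑ y : Fin r → V,
      (univ.filter fun x : V => (Fin.cons x y : Fin (r + 1) → V) ∈ A).card := by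
  rw [card_eq_sum_card_fiberwise (f := Fin.tail) (t := univ) (fun _ _ => mem_coe.2 (mem_univ _))]
  refine sum_congr rfl fun y _ => ?_
  refine card_nbij' (fun g => g 0) (fun x => Fin.cons x y) ?_ ?_ ?_ ?_
  · intro g hg
    obtain ⟨h1, rfl⟩ := mem_filter.1 (mem_coe.1 hg)
    simpa using h1
  · intro x hx
    simpa using hx
  · intro g hg
    obtain ⟨h1, rfl⟩ := mem_filter.1 (mem_coe.1 hg)
    exact Fin.cons_self_tail g
  · intro x _
    simp

/-- Erdős' theorem on complete `(r + 1)`-partite subgraphs, for sets of tuples. -/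
theorem exists_box (t : ℕ) (ht : 1 ≤ t) (r : ℕ) :
    ∃ C : ℝ, 0 < C ∧ ∀ (V : Type) [Fintype V] [DecidableEq V] (A : Finset (Fin (r + 1) → V)),
      t ≤ Fintype.card V →
      C * (Fintype.card V : ℝ) ^ ((r + 1 : ℝ) - (1 / (t : ℝ)) ^ r) ≤ A.card →
      ∃ B : Fin (r + 1) → Finset V, (∀ i, (B i).card = t) ∧ ∀ g, (∀ i, g i ∈ B i) → g ∈ A := by
  have ht0 : (0 : ℝ) < t := by exact_mod_cast ht
  induction r with
  | zero =>
    refine ⟨t, ht0, fun V _ _ A _ hA => ?_⟩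
    have hA' : t ≤ (A.image fun g => g 0).card := by
      rw [card_image_of_injective]
      · simpa using hA
      · intro g g' h
        funext i
        rw [Fin.fin_one_eq_zero i]
        exact h
    obtain ⟨B, hB, hBt⟩ := exists_subset_card_eq hA'
    refine ⟨fun _ => B, fun _ => hBt, fun g hg => ?_⟩
    obtain ⟨g', hg', h⟩ := mem_image.1 (hB (hg 0))
    convert hg'
    funext i
    rw [Fin.fin_one_eq_zero i]
    exact h.symm
  | succ r ih =>
    obtain ⟨C, hC, ih⟩ := ih
    refine ⟨C + t ^ 2 + 1, by positivity, fun V _ _ A hn hA => ?_⟩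
    set n := Fintype.card V with hn'
    have hn1 : (1 : ℝ) ≤ n := by exact_mod_cast ht.trans hn
    have hn0 : (0 : ℝ) < n := by linarith
    set N : (Fin (r + 1) → V) → Finset V :=
      fun y => univ.filter fun x : V => (Fin.cons x y : Fin (r + 2) → V) ∈ A with hN
    obtain ⟨T, hT, hsum⟩ := exists_subset_common univ N t hn
    set A' : Finset (Fin (r + 1) → V) := univ.filter fun y => T ⊆ N y with hA'
    set η : ℝ := (1 / (t : ℝ)) ^ r with hη
    have hη1 : η ≤ 1 := pow_le_one₀ (by positivity)
      (by rw [div_le_one ht0]; exact_mod_cast ht)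
    have hηt : (1 / (t : ℝ)) ^ (r + 1) * t = η := by
      rw [pow_succ, mul_assoc, one_div_mul_cancel ht0.ne', mul_one]
    have hcard : (A.card : ℝ) = ∑ y, ((N y).card : ℝ) := by
      exact_mod_cast card_eq_sum_card_cons A
    have hpm : (A.card : ℝ) ^ t ≤ ((n : ℝ) ^ (r + 1)) ^ (t - 1) * ∑ y, ((N y).card : ℝ) ^ t := by
      obtain ⟨m, rfl⟩ : ∃ m, t = m + 1 := ⟨t - 1, by omega⟩
      have := pow_sum_div_card_le_sum_pow (s := (univ : Finset (Fin (r + 1) → V)))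
        (f := fun y => ((N y).card : ℝ)) (fun _ _ => by positivity) m
      rw [div_le_iff₀ (by rw [card_univ]; simpa using by positivity), ← hcard] at this
      simpa [mul_comm] using this
    have hAt : (C + t ^ 2) * (n : ℝ) ^ ((t : ℝ) * (r + 2) - η) ≤ (A.card : ℝ) ^ t := by
      have hexp : (n : ℝ) ^ ((t : ℝ) * (r + 2) - η) =
          ((n : ℝ) ^ (((r + 1 : ℕ) : ℝ) + 1 - (1 / (t : ℝ)) ^ (r + 1))) ^ t := by
        rw [← Real.rpow_natCast, ← Real.rpow_mul hn0.le]
        congr 1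
        rw [sub_mul, hηt]
        push_cast; ring
      have hCt : C + t ^ 2 ≤ (C + t ^ 2 + 1) ^ t :=
        (by linarith : C + t ^ 2 ≤ C + t ^ 2 + 1).trans
          (le_self_pow₀ (by nlinarith) (by omega))
      calc _ ≤ (C + t ^ 2 + 1) ^ t * (n : ℝ) ^ ((t : ℝ) * (r + 2) - η) := by gcongr
        _ = ((C + t ^ 2 + 1) * (n : ℝ) ^ (((r + 1 : ℕ) : ℝ) + 1 - (1 / (t : ℝ)) ^ (r + 1))) ^ t := by
          rw [hexp, mul_pow]
        _ ≤ _ := by gcongr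
    have hS : (C + t ^ 2) * (n : ℝ) ^ ((t : ℝ) + r + 1 - η) ≤ ∑ y, ((N y).card : ℝ) ^ t := by
      have hp : (0 : ℝ) < ((n : ℝ) ^ (r + 1)) ^ (t - 1) := by positivity
      refine le_of_mul_le_mul_left (le_trans (le_of_eq ?_) (hAt.trans hpm)) hp
      rw [← pow_mul, ← Real.rpow_natCast, mul_left_comm, ← Real.rpow_add hn0]
      congr 2
      rw [Nat.cast_mul, Nat.cast_sub ht]
      push_cast; ring
    have hsum' : (n : ℝ) * ∑ y, ((N y).card : ℝ) ^ t ≤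
        n ^ (t + 1) * A'.card + t ^ 2 * n ^ t * n ^ (r + 1) := by
      have : ((univ : Finset (Fin (r + 1) → V)).card) = n ^ (r + 1) := by simp [hn']
      rw [this] at hsum
      exact_mod_cast hsum
    have hfin : C * (n : ℝ) ^ ((r + 1 : ℝ) - η) ≤ A'.card := by
      have e1 : (n : ℝ) * (n : ℝ) ^ ((t : ℝ) + r + 1 - η) =
          n ^ (t + 1) * (n : ℝ) ^ ((r + 1 : ℝ) - η) := by
        rw [← Real.rpow_natCast (n : ℝ) (t + 1), ← Real.rpow_add hn0, ← Real.rpow_one_add' hn0.le]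
        · congr 1; push_cast; ring
        · have : (0:ℝ) ≤ r := by positivity
          linarith
      have e2 : (n : ℝ) ^ t * n ^ (r + 1) ≤ n ^ (t + 1) * (n : ℝ) ^ ((r + 1 : ℝ) - η) := by
        have : (n : ℝ) ^ r ≤ (n : ℝ) ^ ((r + 1 : ℝ) - η) := by
          rw [← Real.rpow_natCast]
          exact Real.rpow_le_rpow_of_exponent_le hn1 (by linarith)
        calc (n : ℝ) ^ t * n ^ (r + 1) = n ^ (t + 1) * (n : ℝ) ^ r := by ring
          _ ≤ _ := by gcongr
      have hp : (0 : ℝ) < (n : ℝ) ^ (t + 1) := by positivity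
      have h3 := mul_le_mul_of_nonneg_left hS hn0.le
      have h4 : (0 : ℝ) ≤ (t : ℝ) ^ 2 := by positivity
      refine le_of_mul_le_mul_left ?_ hp
      nlinarith [mul_le_mul_of_nonneg_left e2 h4]
    obtain ⟨B, hB, hBA⟩ := ih V A' hn hfin
    refine ⟨Fin.cons T B, fun i => ?_, fun g hg => ?_⟩
    · refine Fin.cases ?_ (fun j => ?_) i
      · simpa using hT
      · simpa using hB j
    · have h1 : Fin.tail g ∈ A' := hBA _ fun i => by simpa [Fin.tail] using hg i.succ
      have h2 := (mem_filter.1 h1).2 (by simpa using hg 0 : g 0 ∈ T)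
      simpa [hN] using h2

theorem degS_le {V : Type} [Fintype V] [DecidableEq V] {k : ℕ} {E : Finset (Finset V)}
    (hE : IsKGraph k E) {S : Finset V} (hS : S.card + 1 = k) :
    degS E S ≤ (univ.filter fun x => x ∉ S ∧ insert x S ∈ E).card := by
  refine (card_le_card fun e he => ?_).trans (card_image_le (f := fun x => insert x S))
  obtain ⟨heE, hSe⟩ := mem_filter.1 he
  have h1 : (e \ S).card = 1 := by rw [card_sdiff_of_subset hSe, hE e heE]; omega
  obtain ⟨x, hx⟩ := card_eq_one.1 h1
  have hxe : insert x S = e := by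
    rw [insert_eq, ← hx, sdiff_union_of_subset hSe]
  have hxS : x ∉ S := (mem_sdiff.1 (hx ▸ mem_singleton_self x : x ∈ e \ S)).2
  exact mem_image.2 ⟨x, by simp [hxS, hxe, heE], hxe⟩

theorem exists_tight_cycle_of_box {V : Type} [Fintype V] [DecidableEq V] {k t : ℕ}
    (hk : 0 < k) {E : Finset (Finset V)} (hE : IsKGraph k E) (P : Fin k → Finset V)
    (hP : ∀ i, (P i).card = t) (hPE : ∀ g : Fin k → V, (∀ i, g i ∈ P i) → univ.image g ∈ E)
    {v : V} {i₀ : Fin k} (hv : v ∈ P i₀) :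
    ∃ C : List V, C.length = k * t ∧ IsTightCycleList k E C ∧ v ∈ C := by
  have ht : 0 < t := by rw [← hP i₀]; exact card_pos.2 ⟨v, hv⟩
  have hinjP : ∀ g : Fin k → V, (∀ i, g i ∈ P i) → Function.Injective g := fun g hg => by
    rw [← Set.injOn_univ, ← coe_univ, ← card_image_iff, hE _ (hPE g hg)]
    simp
  let p : ∀ i, Fin t ≃ P i := fun i => ((P i).equivFinOfCardEq (hP i)).symm
  let f : ℕ → V := fun j => p ⟨j % k, Nat.mod_lt _ hk⟩ ⟨j / k % t, Nat.mod_lt _ ht⟩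
  have hf : ∀ j, f j ∈ P ⟨j % k, Nat.mod_lt _ hk⟩ := fun j => (p _ _).2
  have hfp : ∀ (j : ℕ) (a : Fin k) (b : Fin t), j % k = a → j / k % t = b → f j = p a b :=
    fun j a b ha hb => by
      obtain rfl : ⟨j % k, Nat.mod_lt _ hk⟩ = a := Fin.ext ha
      obtain rfl : ⟨j / k % t, Nat.mod_lt _ ht⟩ = b := Fin.ext hb
      rfl
  have hper : ∀ j, f (k * t + j) = f j := fun j => by
    have h1 : (k * t + j) % k = j % k := Nat.mul_add_mod _ _ _
    have h2 : (k * t + j) / k % t = j / k % t := by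
      rw [Nat.mul_add_div hk, Nat.add_mod_left]
    exact hfp _ _ _ h1 h2
  have hclass : ∀ i j, f i = f j → i % k = j % k := fun i j h => by
    by_contra hne
    let a : Fin k := ⟨i % k, Nat.mod_lt _ hk⟩
    let b : Fin k := ⟨j % k, Nat.mod_lt _ hk⟩
    have hab : a ≠ b := fun h => hne (Fin.mk.inj h)
    let g : Fin k → V := fun c => if c = a then f i else if c = b then f j else
      p c ⟨0, ht⟩
    have hg : ∀ c, g c ∈ P c := fun c => by
      by_cases hca : c = a
      · subst hca; simpa [g] using hf i
      · by_cases hcb : c = b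
        · subst hcb; simpa [g, hca] using hf j
        · simp [g, hca, hcb]
    refine hab (hinjP g hg ?_)
    simp [g, hab.symm, h]
  have hfinj : ∀ i < k * t, ∀ j < k * t, f i = f j → i = j := fun i hi j hj h => by
    have hc := hclass i j h
    rw [hfp i ⟨j % k, Nat.mod_lt _ hk⟩ ⟨i / k % t, Nat.mod_lt _ ht⟩ hc rfl] at h
    have h2 := (p _).injective (Subtype.ext h)
    have h3 : i / k % t = j / k % t := Fin.mk.inj h2
    rw [Nat.mod_eq_of_lt (Nat.div_lt_of_lt_mul hi),
      Nat.mod_eq_of_lt (Nat.div_lt_of_lt_mul hj)] at h3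
    rw [← Nat.div_add_mod i k, ← Nat.div_add_mod j k, h3, hc]
  have hwin : ∀ i, (List.map f (List.range' i k)).toFinset ∈ E := fun i => by
    let w : Fin k → ℕ := fun c => i + (c + (k - 1) * i) % k
    have hw : ∀ c, w c % k = c := fun c => by
      have : i + (c + (k - 1) * i) = c + k * i := by
        obtain ⟨m, rfl⟩ : ∃ m, k = m + 1 := ⟨k - 1, by omega⟩
        simp; ring
      simp only [w]
      rw [Nat.add_mod_mod, this, Nat.add_mul_mod_self_left, Nat.mod_eq_of_lt c.2]
    have hgE := hPE (fun c => f (w c)) fun c => by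
      have := hf (w c)
      simpa only [hw c] using this
    convert hgE using 1
    symm
    refine eq_of_subset_of_card_le (fun x hx => ?_) ?_
    · obtain ⟨c, -, rfl⟩ := mem_image.1 hx
      have := Nat.mod_lt (c + (k - 1) * i) hk
      rw [List.mem_toFinset, List.mem_map]
      refine ⟨w c, ?_, rfl⟩
      rw [List.mem_range'_1]
      exact ⟨by simp [w], by simp only [w]; omega⟩
    · rw [hE _ hgE]
      exact (List.toFinset_card_le _).trans (by simp)
  refine ⟨(List.range (k * t)).map f, by simp, ⟨?_, fun i hi => ?_⟩, ?_⟩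
  · exact List.Nodup.map_on (fun i hi j hj h =>
      hfinj i (List.mem_range.1 hi) j (List.mem_range.1 hj) h) List.nodup_range
  · have hi' : i < k * t := by simpa using hi
    have hkt : k ≤ k * t := Nat.le_mul_of_pos_right k ht
    have hdouble : (List.range (k * t)).map f ++ (List.range (k * t)).map f =
        (List.range (k * t + k * t)).map f := by
      rw [List.range_add, List.map_append, List.map_map]
      congr 1
      exact List.map_congr_left fun j _ => (hper j).symm
    rw [hdouble, ← List.map_drop, ← List.map_take, List.range_eq_range', List.drop_range',
      List.take_range'_of_length_ge (by omega)]
    simpa using hwin i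
  · have hj := ((p i₀).symm ⟨v, hv⟩).2
    set j := (p i₀).symm ⟨v, hv⟩ with hjdef
    refine List.mem_map.2 ⟨k * j + i₀, List.mem_range.2 ?_, ?_⟩
    · have : k * (j + 1) ≤ k * t := Nat.mul_le_mul_left k hj
      have := i₀.2
      rw [Nat.mul_add] at *
      omega
    · have h1 : (k * j + i₀) % k = i₀ := by
        rw [Nat.mul_add_mod, Nat.mod_eq_of_lt i₀.2]
      have h2 : (k * j + i₀) / k % t = j := by
        rw [Nat.mul_add_div hk, Nat.div_eq_of_lt i₀.2, add_zero, Nat.mod_eq_of_lt hj]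
      rw [hfp _ i₀ j h1 h2, hjdef, Equiv.apply_symm_apply]

theorem pow_le_card_tuples_avoiding {V : Type} [Fintype V] [DecidableEq V] (v : V) (q : ℕ) :
    (Fintype.card V - q) ^ q ≤
      (univ.filter fun f : Fin q → V => (insert v (univ.image f)).card = q + 1).card := by
  have h1 : (Fintype.card V - q) ^ q ≤ Fintype.card (Fin q ↪ {x : V // x ≠ v}) := by
    rw [Fintype.card_embedding_eq, Fintype.card_fin, Fintype.card_subtype_compl,
      Fintype.card_subtype_eq]
    refine le_trans (le_of_eq ?_) (Nat.pow_sub_le_descFactorial _ _)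
    have : 0 < Fintype.card V := Fintype.card_pos_iff.2 ⟨v⟩
    congr 2
    omega
  refine h1.trans ?_
  rw [← card_univ]
  refine card_le_card_of_injOn (fun f i => (f i : V)) (fun f _ => ?_) ?_
  · rw [mem_coe, mem_filter]
    refine ⟨mem_univ _, ?_⟩
    rw [card_insert_of_notMem, card_image_of_injective, card_univ, Fintype.card_fin]
    · exact Subtype.val_injective.comp f.injective
    · intro h
      obtain ⟨i, -, hi⟩ := mem_image.1 h
      exact (f i).2 hi
  · intro f _ g _ h
    ext i
    exact congrFun h i

theorem image_cons {V : Type} [DecidableEq V] {r : ℕ} (x : V) (f : Fin r → V) :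
    univ.image (Fin.cons x f : Fin (r + 1) → V) = insert x (univ.image f) := by
  ext y
  simp [Fin.exists_fin_succ, eq_comm]

/-- A vertex of a `(q + 2)`-graph of minimum codegree at least `D` lies in many ordered edges. -/
theorem pow_mul_le_card_link {V : Type} [Fintype V] [DecidableEq V] {q : ℕ}
    {E : Finset (Finset V)} (hE : IsKGraph (q + 2) E) {D : ℝ}
    (hD : ∀ S : Finset V, S.card = q + 1 → D ≤ degS E S) (hD0 : 0 ≤ D) (v : V) :
    (((Fintype.card V - q) ^ q : ℕ) : ℝ) * D ≤
      (univ.filter fun y : Fin (q + 1) → V => insert v (univ.image y) ∈ E).card := by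
  rw [card_eq_sum_card_cons]
  set F := univ.filter fun f : Fin q → V => (insert v (univ.image f)).card = q + 1 with hF
  have hFc : (((Fintype.card V - q) ^ q : ℕ) : ℝ) ≤ F.card := by
    exact_mod_cast pow_le_card_tuples_avoiding v q
  push_cast
  calc _ ≤ (F.card : ℝ) * D := by gcongr; exact_mod_cast hFc
    _ = ∑ f ∈ F, D := by simp
    _ ≤ ∑ f ∈ F, ((univ.filter fun x : V => (Fin.cons x f : Fin (q + 1) → V) ∈
          univ.filter fun y : Fin (q + 1) → V => insert v (univ.image y) ∈ E).card : ℝ) := by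
        refine sum_le_sum fun f hf => ?_
        have hfc := (mem_filter.1 hf).2
        refine (hD _ hfc).trans ?_
        norm_cast
        refine (degS_le hE (by omega)).trans (card_le_card fun x hx => ?_)
        have h2 := (mem_filter.1 hx).2.2
        rw [mem_filter, mem_filter, image_cons, insert_comm]
        exact ⟨mem_univ _, mem_univ _, h2⟩
    _ ≤ _ := sum_le_sum_of_subset_of_nonneg (subset_univ _) fun _ _ _ => by positivity

theorem exists_tight_cycle_of_codegree (q t : ℕ) (ht : 1 ≤ t) :
    ∃ c : ℝ, 0 < c ∧ ∀ (V : Type) [Fintype V] [DecidableEq V] (E : Finset (Finset V)),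
      IsKGraph (q + 2) E → 2 * q + t ≤ Fintype.card V →
      (∀ S : Finset V, S.card = q + 1 →
        c * (Fintype.card V : ℝ) ^ ((1 : ℝ) - (1 / (t : ℝ)) ^ (q + 1)) ≤ degS E S) →
      ∀ v : V, ∃ C : List V, C.length = (q + 2) * t ∧ IsTightCycleList (q + 2) E C ∧ v ∈ C := by
  obtain ⟨K, hK, hbox⟩ := exists_box t ht q
  obtain ⟨m, rfl⟩ : ∃ m, t = m + 1 := ⟨t - 1, by omega⟩
  set t := m + 1 with ht'
  have ht0 : (0 : ℝ) < t := by exact_mod_cast ht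
  refine ⟨2 ^ q * K + m ^ 2 + 2, by positivity, fun V _ _ E hE hn hdeg v => ?_⟩
  set c : ℝ := 2 ^ q * K + m ^ 2 + 2 with hc
  set n := Fintype.card V with hn'
  have hn1 : (1 : ℝ) ≤ n := by exact_mod_cast (by omega : 1 ≤ n)
  have hn0 : (0 : ℝ) < n := by linarith
  set θ : ℝ := (1 / (t : ℝ)) ^ (q + 1) with hθ
  have hθt : θ * (m + 1) = (1 / (t : ℝ)) ^ q := by
    have : ((m : ℝ) + 1) = t := by simp [ht']
    rw [hθ, pow_succ, mul_assoc, this, one_div_mul_cancel ht0.ne', mul_one]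
  have hθ0 : 0 ≤ θ := by positivity
  have hη1 : (1 / (t : ℝ)) ^ q ≤ 1 := pow_le_one₀ (by positivity)
    (by rw [div_le_one ht0]; exact_mod_cast ht)
  have hm0 : (0 : ℝ) ≤ m := by positivity
  have hm2 : (0 : ℝ) ≤ (m : ℝ) ^ 2 := by positivity
  have hKq : 0 < 2 ^ q * K := by positivity
  have hθm : θ * m ≤ 1 := by nlinarith
  have hθ1 : θ ≤ 1 := by nlinarith
  set X : ℝ := (n : ℝ) ^ (1 - θ) with hX
  have hX1 : 1 ≤ X := Real.one_le_rpow hn1 (by linarith)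
  set L := univ.filter fun y : Fin (q + 1) → V => insert v (univ.image y) ∈ E with hL
  set N : (Fin (q + 1) → V) → Finset V :=
    fun y => univ.filter fun x => x ≠ v ∧ insert x (univ.image y) ∈ E with hN
  have hNcard : ∀ y ∈ L, (c - 1) * X ≤ (N y).card := fun y hy => by
    have hyE := (mem_filter.1 hy).2
    have hyc : (univ.image y).card = q + 1 := by
      have h1 := hE _ hyE
      have h2 := card_insert_le v (univ.image y)
      have h3 : (univ.image y).card ≤ q + 1 := card_image_le.trans (by simp)
      omega
    have h1 := (hdeg _ hyc).trans (Nat.cast_le.2 (degS_le hE (by omega)))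
    have h2 : (univ.filter fun x => x ∉ univ.image y ∧ insert x (univ.image y) ∈ E).card ≤
        (N y).card + 1 := by
      refine (card_le_card fun x hx => ?_).trans (card_insert_le v (N y))
      obtain ⟨-, -, hx⟩ := mem_filter.1 hx
      by_cases hxv : x = v
      · simp [hxv]
      · exact mem_insert_of_mem (by simp [hN, hxv, hx])
    have h3 : ((univ.filter fun x => x ∉ univ.image y ∧ insert x (univ.image y) ∈ E).card : ℝ) ≤
        (N y).card + 1 := by exact_mod_cast h2
    nlinarith
  have hLcard : K * n ^ q * X ≤ L.card := by
    refine le_trans ?_ (pow_mul_le_card_link hE hdeg (by positivity) v)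
    have h1 : ((n : ℝ) / 2) ^ q ≤ (((n - q) ^ q : ℕ) : ℝ) := by
      rw [Nat.cast_pow, Nat.cast_sub (by omega)]
      have : (2 * q + t : ℝ) ≤ n := by exact_mod_cast hn
      gcongr
      linarith
    calc K * n ^ q * X = ((n : ℝ) / 2) ^ q * ((2 ^ q * K) * X) := by
          rw [div_pow]; field_simp
      _ ≤ ((n : ℝ) / 2) ^ q * (c * X) := by gcongr; linarith
      _ ≤ _ := by gcongr
  obtain ⟨T, hT, hsum⟩ := exists_subset_common L N m (by omega)
  have hA : K * (n : ℝ) ^ ((q + 1 : ℝ) - (1 / (t : ℝ)) ^ q) ≤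
      ((L.filter fun y => T ⊆ N y).card : ℝ) := by
    have hcoef : 1 ≤ (c - 1) ^ m - m ^ 2 := by
      rcases Nat.eq_zero_or_pos m with h0 | h0
      · simp [h0]
      · have : c - 1 ≤ (c - 1) ^ m := le_self_pow₀ (by linarith) h0.ne'
        linarith
    have hXm : X ^ m = (n : ℝ) ^ (m - θ * m) := by
      rw [hX, ← Real.rpow_natCast, ← Real.rpow_mul hn0.le]; congr 1; ring
    have hnX : (n : ℝ) ^ m ≤ n * X ^ m := by
      rw [hXm, ← Real.rpow_natCast, ← Real.rpow_one_add' hn0.le (by nlinarith)]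
      exact Real.rpow_le_rpow_of_exponent_le hn1 (by linarith)
    have hS : L.card * ((c - 1) * X) ^ m ≤ ∑ y ∈ L, ((N y).card : ℝ) ^ m := by
      rw [← nsmul_eq_mul]
      refine card_nsmul_le_sum _ _ _ fun y hy => ?_
      have : 0 ≤ c - 1 := by linarith
      have := hNcard y hy
      gcongr
    have hsum' : (n : ℝ) * ∑ y ∈ L, ((N y).card : ℝ) ^ m ≤
        n ^ (m + 1) * (L.filter fun y => T ⊆ N y).card + m ^ 2 * n ^ m * L.card := by
      exact_mod_cast hsum
    have hmain : (n : ℝ) * (X ^ m * L.card) ≤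
        n * (n ^ m * (L.filter fun y => T ⊆ N y).card) := by
      calc (n : ℝ) * (X ^ m * L.card)
          ≤ ((c - 1) ^ m - m ^ 2) * (n * (X ^ m * L.card)) :=
            le_mul_of_one_le_left (by positivity) hcoef
        _ = n * (L.card * ((c - 1) * X) ^ m) - m ^ 2 * (n * X ^ m) * L.card := by
            rw [mul_pow]; ring
        _ ≤ n * ∑ y ∈ L, ((N y).card : ℝ) ^ m - m ^ 2 * n ^ m * L.card := by gcongr
        _ ≤ n ^ (m + 1) * (L.filter fun y => T ⊆ N y).card := by linarith
        _ = _ := by ring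
    have hpos : (0 : ℝ) < n ^ m := by positivity
    refine le_of_mul_le_mul_left ?_ hpos
    refine le_trans ?_ (le_of_mul_le_mul_left hmain hn0)
    calc (n : ℝ) ^ m * (K * (n : ℝ) ^ ((q + 1 : ℝ) - (1 / (t : ℝ)) ^ q))
        = X ^ m * (K * n ^ q * X) := by
          rw [hXm, hX, ← hθt, ← Real.rpow_natCast, ← Real.rpow_natCast]
          have e : ∀ a b : ℝ, (n : ℝ) ^ a * (n : ℝ) ^ b = (n : ℝ) ^ (a + b) :=
            fun a b => (Real.rpow_add hn0 a b).symm
          rw [mul_left_comm, e, mul_assoc K, e, mul_left_comm, e]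
          congr 2
          ring
      _ ≤ _ := by gcongr
  obtain ⟨B, hB, hBA⟩ := hbox V _ (by omega) hA
  have hvT : v ∉ T := fun hv => by
    have hpos := lt_of_lt_of_le (by positivity) hA
    obtain ⟨y, hy⟩ := card_pos.1 (Nat.cast_pos.1 hpos)
    have := (mem_filter.1 ((mem_filter.1 hy).2 hv)).2.1
    exact this rfl
  refine exists_tight_cycle_of_box (by omega) hE (Fin.cons (insert v T) B)
    (fun i => ?_) (fun g hg => ?_) (i₀ := 0) (by simp)
  · refine Fin.cases ?_ (fun j => ?_) i
    · simp [card_insert_of_notMem hvT, hT, ht']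
    · simpa using hB j
  · have h1 := hBA (Fin.tail g) fun i => by simpa [Fin.tail] using hg i.succ
    rw [mem_filter, hL, mem_filter] at h1
    rw [← Fin.cons_self_tail g, image_cons]
    have h0 : g 0 = v ∨ g 0 ∈ T := by simpa using hg 0
    rcases h0 with h0 | h0
    · rw [h0]; exact h1.1.2
    · exact (mem_filter.1 (h1.2 h0)).2.2

/-- For all `2 ≤ k ≤ s` with `k ∣ s`, there are `n₀` and `c > 0` such that every
`k`-graph on `n ≥ n₀` vertices without a `C_s^k`-covering has minimum codegree at most
`c · n^(1 - (k/s)^(k-1))`. -/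
theorem covering_threshold_s_divisible_by_k (k s : ℕ) (hk : 2 ≤ k) (hks : k ≤ s)
    (hdvd : k ∣ s) :
    ∃ (n₀ : ℕ) (c : ℝ), 0 < c ∧
      ∀ (V : Type) [Fintype V] [DecidableEq V] (E : Finset (Finset V)),
        IsKGraph k E → n₀ ≤ Fintype.card V → ¬ HasCsCovering k s E →
        ∃ S : Finset V, S.card = k - 1 ∧
          (degS E S : ℝ) ≤ c * (Fintype.card V : ℝ) ^ ((1 : ℝ) - ((k : ℝ) / (s : ℝ)) ^ (k - 1)) := by
  obtain ⟨q, rfl⟩ : ∃ q, k = q + 2 := ⟨k - 2, by omega⟩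
  obtain ⟨t, rfl⟩ := hdvd
  have ht : 1 ≤ t := Nat.one_le_iff_ne_zero.2 fun h => by simp [h] at hks
  obtain ⟨c, hc, h⟩ := exists_tight_cycle_of_codegree q t ht
  refine ⟨2 * q + t, c, hc, fun V _ _ E hE hn hcov => ?_⟩
  by_contra! hdeg
  refine hcov (h V E hE hn fun S hS => ?_)
  have hq : ((q + 2 : ℕ) : ℝ) ≠ 0 := by positivity
  have := (hdeg S hS).le
  rwa [Nat.cast_mul, div_mul_eq_div_div, div_self hq] at this
end

section
/- Let k, s be integers with k ≥ 2 and s ≥ 2k². For every γ > 0 there exists n₀ = n₀(k, s, γ) such that for all n ≥ n₀: every k-graph H on n vertices with δ_{k−1}(H) ≥ (1/2 + γ)n has a C_s^k-covering. -/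
set_option autoImplicit false

open Finset

/-- One coordinate of a dense relation can be blown up `t + 1` times: this is Jensen's
inequality for the degrees of the vertices of `β`. -/
lemma card_blowup_coord {α β : Type} [Finite α] [Finite β] (R : α → β → Prop) {c : ℝ}
    (hc : 0 ≤ c) (t : ℕ)
    (h : c * (Nat.card α * Nat.card β) ≤ Nat.card {p : α × β // R p.1 p.2}) :
    c ^ (t + 1) * ((Nat.card α : ℝ) ^ (t + 1) * Nat.card β) ≤
      Nat.card {p : (Fin (t + 1) → α) × β // ∀ j, R (p.1 j) p.2} := by
  classical
  have := Fintype.ofFinite α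
  have := Fintype.ofFinite β
  have h₁ : Nat.card {p : α × β // R p.1 p.2} = ∑ b : β, Nat.card {a // R a b} := by
    rw [← Nat.card_sigma]
    exact Nat.card_congr
      { toFun := fun p => ⟨p.1.2, p.1.1, p.2⟩
        invFun := fun q => ⟨(q.2.1, q.1), q.2.2⟩
        left_inv := fun _ => rfl
        right_inv := fun _ => rfl }
  have h₂ : Nat.card {p : (Fin (t + 1) → α) × β // ∀ j, R (p.1 j) p.2} =
      ∑ b : β, Nat.card {a // R a b} ^ (t + 1) := by
    have : ∀ b, Nat.card {a // R a b} ^ (t + 1) = Nat.card (Fin (t + 1) → {a // R a b}) := by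
      intro b; simp
    simp_rw [this]
    rw [← Nat.card_sigma]
    exact Nat.card_congr
      { toFun := fun p => ⟨p.1.2, fun j => ⟨p.1.1 j, p.2 j⟩⟩
        invFun := fun q => ⟨(fun j => (q.2 j).1, q.1), fun j => (q.2 j).2⟩
        left_inv := fun _ => rfl
        right_inv := fun _ => rfl }
  rw [h₁] at h
  rw [h₂]
  push_cast at h ⊢
  rcases Nat.eq_zero_or_pos (Nat.card β) with hβ | hβ
  · rw [hβ]
    simp only [Nat.cast_zero, mul_zero]
    positivity
  have hβ' : (0 : ℝ) < Nat.card β := by exact_mod_cast hβ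
  have key := pow_sum_div_card_le_sum_pow (s := (univ : Finset β))
    (f := fun b => (Nat.card {a // R a b} : ℝ)) (fun _ _ => Nat.cast_nonneg _) t
  refine le_trans ?_ key
  rw [card_univ, ← Nat.card_eq_fintype_card, le_div_iff₀ (by positivity)]
  calc _ = (c * (Nat.card α * Nat.card β)) ^ (t + 1) := by ring
    _ ≤ _ := pow_le_pow_left₀ (by positivity) h _

/-- A dense `m`-ary relation with parameters contains a proportion of complete `m`-partite
blow-ups with parts of size `t + 1`. -/
lemma card_blowup {V : Type} [Finite V] (t m : ℕ) : ∀ {W : Type} [Finite W]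
    (P : (Fin m → V) → W → Prop) {c : ℝ}, 0 ≤ c →
    c * ((Nat.card V : ℝ) ^ m * Nat.card W) ≤ Nat.card {p : (Fin m → V) × W // P p.1 p.2} →
    c ^ ((t + 1) ^ m) * (((Nat.card V : ℝ) ^ (t + 1)) ^ m * Nat.card W) ≤
      Nat.card {p : (Fin m → Fin (t + 1) → V) × W //
        ∀ g : Fin m → Fin (t + 1), P (fun i => p.1 i (g i)) p.2} := by
  induction m with
  | zero =>
    intro W _ P c _ h
    simp only [pow_zero, pow_one] at h ⊢
    refine h.trans ?_
    norm_cast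
    refine Nat.card_le_card_of_injective
      (fun p => ⟨(fun i => i.elim0, p.1.2), fun g => ?_⟩) ?_
    · convert p.2
    · rintro ⟨⟨x, w⟩, _⟩ ⟨⟨x', w'⟩, _⟩ hx
      simp only [Subtype.mk.injEq, Prod.mk.injEq, true_and] at hx
      simp [hx, Subsingleton.elim x x']
  | succ m ih =>
    intro W _ P c hc h
    have h₁ := card_blowup_coord (α := V) (β := (Fin m → V) × W)
      (fun a q => P (Fin.cons a q.1) q.2) hc t (by
        refine le_trans (le_of_eq ?_) (h.trans ?_)
        · simp only [Nat.card_prod, Nat.card_fun, Nat.card_fin]; push_cast; ring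
        · norm_cast
          refine Nat.card_le_card_of_injective
            (fun p => ⟨(p.1.1 0, (Fin.tail p.1.1, p.1.2)), ?_⟩) ?_
          · simpa using p.2
          · rintro ⟨⟨x, w⟩, _⟩ ⟨⟨x', w'⟩, _⟩ hx
            simp only [Subtype.mk.injEq, Prod.mk.injEq] at hx
            obtain ⟨h0, h1, rfl⟩ := hx
            simp only [Subtype.mk.injEq, Prod.mk.injEq, and_true]
            rw [← Fin.cons_self_tail x, ← Fin.cons_self_tail x', h0, h1])
    have h₂ := ih (W := (Fin (t + 1) → V) × W)
      (fun x q => ∀ j, P (Fin.cons (q.1 j) x) q.2) (c := c ^ (t + 1)) (by positivity) (by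
        refine le_trans (le_of_eq ?_) (h₁.trans ?_)
        · simp only [Nat.card_prod, Nat.card_fun, Nat.card_fin]; push_cast; ring
        · norm_cast
          refine Nat.card_le_card_of_injective
            (fun p => ⟨(p.1.2.1, (p.1.1, p.1.2.2)), p.2⟩) ?_
          rintro ⟨⟨x, y, w⟩, _⟩ ⟨⟨x', y', w'⟩, _⟩ hx
          simp only [Subtype.mk.injEq, Prod.mk.injEq] at hx ⊢
          tauto)
    refine le_trans (le_of_eq ?_) (h₂.trans ?_)
    · simp only [Nat.card_prod, Nat.card_fun, Nat.card_fin]; push_cast; ring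
    · norm_cast
      refine Nat.card_le_card_of_injective
        (fun p => ⟨(Fin.cons p.1.2.1 p.1.1, p.1.2.2), fun g => ?_⟩) ?_
      · convert p.2 (Fin.tail g) (g 0) using 1
        funext i
        refine Fin.cases ?_ (fun i => ?_) i <;> simp [Fin.tail]
      · rintro ⟨⟨x, y, w⟩, _⟩ ⟨⟨x', y', w'⟩, _⟩ hx
        simp only [Subtype.mk.injEq, Prod.mk.injEq] at hx ⊢
        obtain ⟨h0, h1⟩ := hx
        have := Fin.cons_inj.mp h0
        tauto

/-- Starting from `π`, the `l`-th transposition moves the value `l` to position `l`, so that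
after `k` steps the identity is reached. -/
def sortStep {k : ℕ} (π : Equiv.Perm (Fin k)) : ℕ → Equiv.Perm (Fin k)
  | 0 => π
  | l + 1 => if h : l < k then
      sortStep π l * Equiv.swap ⟨l, h⟩ ((sortStep π l).symm ⟨l, h⟩) else sortStep π l

lemma sortStep_succ_self {k : ℕ} (π : Equiv.Perm (Fin k)) (l : Fin k) :
    sortStep π (l + 1) l = l := by
  simp [sortStep]

lemma sortStep_succ_of_ne {k : ℕ} (π : Equiv.Perm (Fin k)) (l j : Fin k) (hj : j ≠ l)
    (hl : sortStep π l j ≠ l) : sortStep π (l + 1) j = sortStep π l j := by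
  have : j ≠ (sortStep π l).symm l := fun h => hl (by simp [h])
  simp [sortStep, Equiv.swap_apply_of_ne_of_ne hj this]

lemma sortStep_of_lt {k : ℕ} (π : Equiv.Perm (Fin k)) (l : ℕ) (j : Fin k) (hj : (j : ℕ) < l) :
    sortStep π l j = j := by
  induction l with
  | zero => omega
  | succ l ih =>
    rcases Nat.lt_succ_iff_lt_or_eq.mp hj with h | h
    · by_cases hl : l < k
      · have hne : j ≠ ⟨l, hl⟩ := by rintro rfl; simp at h
        rw [sortStep_succ_of_ne π ⟨l, hl⟩ j hne (by rw [ih h]; exact hne), ih h]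
      · simp [sortStep, hl, ih h]
    · subst h
      exact sortStep_succ_self π j

lemma sortStep_eq_one {k : ℕ} (π : Equiv.Perm (Fin k)) {l : ℕ} (hl : k ≤ l) :
    sortStep π l = 1 :=
  Equiv.ext fun j => sortStep_of_lt π l j (j.2.trans_le hl)

/-- The symbol in row `R` and column `j` of the cyclic word: row `2l` spells the permutation
`sortStep π l`, and row `2l + 1` spells `sortStep π (l + 1)` except that column `l` carries an
auxiliary symbol. -/
def wordSymbol {k : ℕ} (π : Equiv.Perm (Fin k)) (R : ℕ) (j : Fin k) : Fin k ⊕ Fin k :=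
  if R % 2 = 1 ∧ (j : ℕ) = R / 2 then Sum.inr j else Sum.inl (sortStep π ((R + 1) / 2) j)

/-- Every `k` consecutive symbols of the word consist of all the letters, or of one auxiliary
symbol `l` together with all the letters but `l`, or all the letters but `sortStep π l l`. -/
lemma wordSymbol_window {k : ℕ} (π : Equiv.Perm (Fin k)) (R c : ℕ) :
    (∃ σ : Equiv.Perm (Fin k), ∀ j : Fin k,
      wordSymbol π (if (j : ℕ) < c then R + 1 else R) j = Sum.inl (σ j)) ∨
    ∃ (l : Fin k) (σ : Equiv.Perm (Fin k)), (σ l = l ∨ σ l = sortStep π l l) ∧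
      wordSymbol π (if (l : ℕ) < c then R + 1 else R) l = Sum.inr l ∧
      ∀ j, j ≠ l → wordSymbol π (if (j : ℕ) < c then R + 1 else R) j = Sum.inl (σ j) := by
  obtain ⟨l, hR | hR⟩ : ∃ l, R = 2 * l ∨ R = 2 * l + 1 := ⟨R / 2, by omega⟩
  · subst hR
    have e0 : ∀ j : Fin k, wordSymbol π (2 * l) j = Sum.inl (sortStep π l j) := by
      intro j
      rw [wordSymbol, if_neg (by omega), show (2 * l + 1) / 2 = l by omega]
    have e1 : ∀ j : Fin k, (j : ℕ) ≠ l →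
        wordSymbol π (2 * l + 1) j = Sum.inl (sortStep π (l + 1) j) := by
      intro j hj
      rw [wordSymbol, if_neg (by omega), show (2 * l + 1 + 1) / 2 = l + 1 by omega]
    by_cases hc : c ≤ l ∨ k ≤ l
    · left
      refine ⟨sortStep π l, fun j => ?_⟩
      split_ifs with h
      · rw [e1 j (by omega), sortStep_of_lt π (l + 1) j (by omega),
          sortStep_of_lt π l j (by omega)]
      · exact e0 j
    · push Not at hc
      obtain ⟨hc, hl⟩ := hc
      right
      lift l to Fin k using hl
      have el : wordSymbol π (if (l : ℕ) < c then 2 * (l : ℕ) + 1 else 2 * l) l = Sum.inr l := by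
        rw [if_pos hc, wordSymbol, if_pos (by omega)]
      by_cases hp : (((sortStep π l).symm l : Fin k) : ℕ) < c
      · refine ⟨l, sortStep π (l + 1), Or.inl (sortStep_succ_self π l), el, fun j hj => ?_⟩
        have hj' : (j : ℕ) ≠ l := fun h => hj (Fin.ext h)
        split_ifs with h
        · exact e1 j hj'
        · rw [e0, sortStep_succ_of_ne π l j hj]
          intro h'
          rw [← Equiv.eq_symm_apply] at h'
          exact h (h' ▸ hp)
      · refine ⟨l, sortStep π l, Or.inr rfl, el, fun j hj => ?_⟩
        have hj' : (j : ℕ) ≠ l := fun h => hj (Fin.ext h)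
        split_ifs with h
        · rw [e1 j hj', sortStep_succ_of_ne π l j hj]
          intro h'
          rw [← Equiv.eq_symm_apply] at h'
          exact hp (h' ▸ h)
        · exact e0 j
  · subst hR
    have e0 : ∀ j : Fin k, wordSymbol π (2 * l + 1 + 1) j = Sum.inl (sortStep π (l + 1) j) := by
      intro j
      rw [wordSymbol, if_neg (by omega), show (2 * l + 1 + 1 + 1) / 2 = l + 1 by omega]
    have e1 : ∀ j : Fin k, (j : ℕ) ≠ l →
        wordSymbol π (2 * l + 1) j = Sum.inl (sortStep π (l + 1) j) := by
      intro j hj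
      rw [wordSymbol, if_neg (by omega), show (2 * l + 1 + 1) / 2 = l + 1 by omega]
    by_cases hc : l < c ∨ k ≤ l
    · left
      refine ⟨sortStep π (l + 1), fun j => ?_⟩
      split_ifs with h
      · exact e0 j
      · exact e1 j (by omega)
    · push Not at hc
      obtain ⟨hc, hl⟩ := hc
      right
      lift l to Fin k using hl
      refine ⟨l, sortStep π (l + 1), Or.inl (sortStep_succ_self π l), ?_, fun j hj => ?_⟩
      · rw [if_neg (by omega), wordSymbol, if_pos (by omega)]
      · split_ifs with h
        · exact e0 j
        · exact e1 j fun h => hj (Fin.ext h)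

/-- A sequence of vertices which is injective on `[0, s)` and repeats its first `k` vertices
from position `s` on is a tight cycle as soon as all its windows are edges. -/
lemma isTightCycleList_ofFn {V : Type} [DecidableEq V] {k s : ℕ} {E : Finset (Finset V)}
    (u : ℕ → V) (hks : k ≤ s)
    (hinj : ∀ p < s, ∀ q < s, u p = u q → p = q) (hper : ∀ j < k, u (s + j) = u j)
    (hE : ∀ i < s, (range k).image (fun j => u (i + j)) ∈ E) :
    IsTightCycleList k E (List.ofFn fun p : Fin s => u p) := by
  refine ⟨List.nodup_ofFn.mpr fun p q h => Fin.ext (hinj p p.2 q q.2 h), fun i hi => ?_⟩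
  simp only [List.length_ofFn] at hi
  have : ((((List.ofFn fun p : Fin s => u p) ++ List.ofFn fun p : Fin s => u p).drop i).take k)
      = (List.range k).map fun j => u (i + j) := by
    apply List.ext_getElem
    · simp; omega
    · intro m h₁ h₂
      simp only [List.length_map, List.length_range] at h₂
      simp only [List.getElem_take, List.getElem_drop, List.getElem_append, List.length_ofFn,
        List.getElem_ofFn, List.getElem_map, List.getElem_range]
      split_ifs with h
      · rfl
      · rw [← hper (i + m - s) (by omega)]
        congr 1
        omega
  rw [this]
  convert hE i hi using 1
  ext y
  simp

lemma image_range_add_eq_image_column {V : Type} [DecidableEq V] {k : ℕ} (u : ℕ → V) (i : ℕ) :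
    (range k).image (fun j => u (i + j)) =
      univ.image fun j : Fin k => u (k * (if (j : ℕ) < i % k then i / k + 1 else i / k) + j) := by
  rcases Nat.eq_zero_or_pos k with rfl | hk
  · simp
  have hi := Nat.div_add_mod i k
  have hc := Nat.mod_lt i hk
  set c := i % k
  set R := i / k
  ext y
  simp only [mem_image, mem_range, mem_univ, true_and]
  constructor
  · rintro ⟨m, hm, rfl⟩
    by_cases h : c + m < k
    · refine ⟨⟨c + m, h⟩, ?_⟩
      rw [if_neg (by simp)]
      congr 1
      simp only
      omega
    · refine ⟨⟨c + m - k, by omega⟩, ?_⟩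
      rw [if_pos (by simp only; omega), mul_add]
      congr 1
      simp only
      omega
  · rintro ⟨j, rfl⟩
    split_ifs with h
    · refine ⟨j + k - c, by omega, ?_⟩
      rw [mul_add]
      congr 1
      omega
    · refine ⟨j - c, by omega, ?_⟩
      congr 1
      omega

/-- A blown-up edge together with auxiliary vertices that can replace `l` and the letter
exchanged with it by the `l`-th transposition contains a tight cycle of length `s` through the
last auxiliary vertex. -/
lemma exists_isTightCycleList_of_blowup {V : Type} [DecidableEq V] {k s : ℕ} (hk : 0 < k)
    (hs : 2 * k ^ 2 ≤ s) {E : Finset (Finset V)} (π : Equiv.Perm (Fin k))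
    (hπ : ∀ j : Fin k, (π j : ℕ) = (s + j) % k) (X : Fin k → Fin s → V) (w : Fin k → V)
    (hinj : Function.Injective (Sum.elim (fun p : Fin k × Fin s => X p.1 p.2) w))
    (hE : ∀ g : Fin k → Fin s, univ.image (fun i => X i (g i)) ∈ E)
    (hw : ∀ (g : Fin k → Fin s) (l : Fin k),
      insert (w l) ((univ.erase l).image fun i => X i (g i)) ∈ E ∧
      insert (w l) ((univ.erase (sortStep π l l)).image fun i => X i (g i)) ∈ E) :
    ∃ C : List V, C.length = s ∧ IsTightCycleList k E C ∧ w ⟨k - 1, by omega⟩ ∈ C := by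
  have hks : k * (2 * k) ≤ s := by nlinarith
  have hks' : k ≤ s := by nlinarith
  have hs0 : 0 < s := by omega
  set u : ℕ → V := fun p =>
    Sum.elim (fun a => X a ⟨p % s, Nat.mod_lt _ hs0⟩) w
      (wordSymbol π (p / k) ⟨p % k, Nat.mod_lt _ hk⟩) with hu
  have hu_col : ∀ (R : ℕ) (j : Fin k), u (k * R + j) =
      Sum.elim (fun a => X a ⟨(k * R + j) % s, Nat.mod_lt _ hs0⟩) w (wordSymbol π R j) := by
    intro R j
    have h₁ : (k * R + j) / k = R := by
      rw [Nat.mul_add_div hk, Nat.div_eq_of_lt j.2, add_zero]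
    have h₂ : (k * R + j) % k = j := by rw [Nat.mul_add_mod, Nat.mod_eq_of_lt j.2]
    simp only [hu, h₁, h₂]
  have hlast : u (k * (2 * (k - 1) + 1) + (k - 1)) = w ⟨k - 1, by omega⟩ := by
    have := hu_col (2 * (k - 1) + 1) ⟨k - 1, by omega⟩
    rw [wordSymbol, if_pos (by simp only; omega)] at this
    exact this
  have hlast' : k * (2 * (k - 1) + 1) + (k - 1) < s := by
    obtain ⟨d, rfl⟩ : ∃ d, k = d + 1 := ⟨k - 1, by omega⟩
    simp only [Nat.add_sub_cancel]
    nlinarith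
  refine ⟨List.ofFn fun p : Fin s => u p, by simp, ?_, ?_⟩
  · apply isTightCycleList_ofFn u hks'
    · intro p hp q hq h
      have : (∃ a b, wordSymbol π (p / k) ⟨p % k, Nat.mod_lt _ hk⟩ = Sum.inl a ∧
          wordSymbol π (q / k) ⟨q % k, Nat.mod_lt _ hk⟩ = Sum.inl b) ∨
          wordSymbol π (p / k) ⟨p % k, Nat.mod_lt _ hk⟩ =
          wordSymbol π (q / k) ⟨q % k, Nat.mod_lt _ hk⟩ := by
        simp only [hu] at h
        generalize wordSymbol π (p / k) ⟨p % k, Nat.mod_lt _ hk⟩ = x at h ⊢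
        generalize wordSymbol π (q / k) ⟨q % k, Nat.mod_lt _ hk⟩ = y at h ⊢
        rcases x with a | l <;> rcases y with b | m
        · exact Or.inl ⟨a, b, rfl, rfl⟩
        · exact absurd (@hinj (Sum.inl (a, _)) (Sum.inr m) h) (by simp)
        · exact absurd (@hinj (Sum.inr l) (Sum.inl (b, _)) h) (by simp)
        · right
          have := @hinj (Sum.inr l) (Sum.inr m) h
          simpa using this
      have hletters : ∀ a b, wordSymbol π (p / k) ⟨p % k, Nat.mod_lt _ hk⟩ = Sum.inl a →
          wordSymbol π (q / k) ⟨q % k, Nat.mod_lt _ hk⟩ = Sum.inl b → p = q := by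
        intro a b ha hb
        simp only [hu, ha, hb, Sum.elim_inl] at h
        have := @hinj (Sum.inl (a, _)) (Sum.inl (b, _)) h
        simp only [Sum.inl.injEq, Prod.mk.injEq, Fin.mk.injEq] at this
        rw [Nat.mod_eq_of_lt hp, Nat.mod_eq_of_lt hq] at this
        exact this.2
      rcases this with ⟨a, b, ha, hb⟩ | heq
      · exact hletters a b ha hb
      · rcases hx : wordSymbol π (p / k) ⟨p % k, Nat.mod_lt _ hk⟩ with a | l
        · exact hletters a a hx (heq ▸ hx)
        · have hy := heq ▸ hx
          rw [wordSymbol] at hx hy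
          split_ifs at hx hy with h₁ h₂
          have h₃ := hx.trans hy.symm
          simp only [Sum.inr.injEq, Fin.mk.injEq] at h₃ h₁ h₂
          rw [← Nat.div_add_mod p k, ← Nat.div_add_mod q k, h₃,
            show p / k = q / k by omega]
    · intro j hj
      have h₁ : 2 * k ≤ (s + j) / k := by
        rw [Nat.le_div_iff_mul_le hk]
        nlinarith
      have h₃ := Nat.mod_lt (s + j) hk
      have h₂ := hu_col 0 ⟨j, hj⟩
      simp only [mul_zero, zero_add] at h₂
      rw [h₂]
      simp only [hu, wordSymbol]
      rw [if_neg (by omega), if_neg (by omega), sortStep_eq_one π (by omega)]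
      simp only [Sum.elim_inl, Equiv.Perm.coe_one, id, Nat.add_mod_left]
      congr 1
      exact Fin.ext (hπ ⟨j, hj⟩).symm
    · intro i _
      rw [image_range_add_eq_image_column]
      simp only [hu_col]
      set τ : Fin k → Fin s := fun j =>
        ⟨(k * (if (j : ℕ) < i % k then i / k + 1 else i / k) + j) % s, Nat.mod_lt _ hs0⟩ with hτ
      rcases wordSymbol_window π (i / k) (i % k) with ⟨σ, hσ⟩ | ⟨l, σ, hl, hσl, hσ⟩
      · convert hE (τ ∘ σ.symm) using 1
        ext y
        simp only [hσ, Sum.elim_inl, mem_image, mem_univ, true_and, Function.comp]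
        exact ⟨fun ⟨j, hj⟩ => ⟨σ j, by rw [← hj, σ.symm_apply_apply]⟩,
          fun ⟨a, ha⟩ => ⟨σ.symm a, by rw [← ha, σ.apply_symm_apply]⟩⟩
      · have key : insert (w l) ((univ.erase (σ l)).image
            fun a => X a ((τ ∘ σ.symm) a)) ∈ E := by
          rcases hl with h | h <;> rw [h]
          · exact (hw _ l).1
          · exact (hw _ l).2
        convert key using 1
        ext y
        simp only [mem_insert, mem_image, mem_univ, true_and, mem_erase, and_true]
        constructor
        · rintro ⟨j, rfl⟩
          by_cases hj : j = l
          · left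
            rw [hj, hσl, Sum.elim_inr]
          · right
            exact ⟨σ j, by simpa using hj, by simp [hσ j hj, hτ]⟩
        · rintro (rfl | ⟨a, ha, rfl⟩)
          · exact ⟨l, by rw [hσl, Sum.elim_inr]⟩
          · have : σ.symm a ≠ l := fun h => ha (by rw [← h]; simp)
            exact ⟨σ.symm a, by rw [hσ _ this]; simp [hτ]⟩
  · rw [← hlast]
    exact List.mem_ofFn.mpr ⟨⟨_, hlast'⟩, rfl⟩

lemma degS_le_card_insert {V : Type} [Fintype V] [DecidableEq V] {k : ℕ} {E : Finset (Finset V)}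
    (hE : IsKGraph k E) {S : Finset V} (hS : S.card + 1 = k) :
    degS E S ≤ #{y | insert y S ∈ E} := by
  refine (card_le_card ?_).trans (card_image_le (f := fun y => insert y S))
  intro f hf
  rw [mem_filter] at hf
  obtain ⟨y, _, rfl⟩ := exists_eq_insert_iff.mpr ⟨hf.2, hS.trans (hE f hf.1).symm⟩
  exact mem_image_of_mem _ (by simpa using hf.1)

lemma two_mul_le_card_common_insert {V : Type} [Fintype V] [DecidableEq V] {k : ℕ}
    {E : Finset (Finset V)} (hE : IsKGraph k E) {γ : ℝ}
    (hdeg : ∀ S : Finset V, S.card = k - 1 →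
      (1 / 2 + γ) * (Fintype.card V : ℝ) ≤ (degS E S : ℝ))
    {A B : Finset V} (hA : A.card + 1 = k) (hB : B.card + 1 = k) :
    2 * γ * Fintype.card V ≤ #{y | insert y A ∈ E ∧ insert y B ∈ E} := by
  have h₁ := hdeg A (by omega)
  have h₂ := hdeg B (by omega)
  have h₃ : (degS E A : ℝ) ≤ _ := Nat.cast_le.mpr (degS_le_card_insert hE hA)
  have h₄ : (degS E B : ℝ) ≤ _ := Nat.cast_le.mpr (degS_le_card_insert hE hB)
  have h₅ := card_union_add_card_inter (univ.filter fun y => insert y A ∈ E)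
    (univ.filter fun y => insert y B ∈ E)
  rw [← filter_and] at h₅
  have h₆ := card_le_univ ((univ.filter fun y => insert y A ∈ E) ∪
    (univ.filter fun y => insert y B ∈ E))
  have h₅' : (_ : ℝ) = _ := congrArg (Nat.cast : ℕ → ℝ) h₅
  have h₆' : (_ : ℝ) ≤ _ := Nat.cast_le.mpr h₆
  push_cast at h₅'
  linarith

lemma card_mul_le_card_extension {A B : Type} [Finite A] [Finite B] (P : A → Prop)
    (Q : A → B → Prop) {b : ℝ} (h : ∀ a, P a → b ≤ Nat.card {y // Q a y}) :
    Nat.card {a // P a} * b ≤ Nat.card {p : A × B // P p.1 ∧ Q p.1 p.2} := by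
  classical
  have := Fintype.ofFinite {a // P a}
  have e : Nat.card {p : A × B // P p.1 ∧ Q p.1 p.2} =
      ∑ a : {a // P a}, Nat.card {y // Q a y} := by
    rw [← Nat.card_sigma]
    exact Nat.card_congr
      { toFun := fun p => ⟨⟨p.1.1, p.2.1⟩, p.1.2, p.2.2⟩
        invFun := fun q => ⟨(q.1.1, q.2.1), q.1.2, q.2.2⟩
        left_inv := fun _ => rfl
        right_inv := fun _ => rfl }
  rw [e, Nat.cast_sum, Nat.card_eq_fintype_card, ← nsmul_eq_mul, ← card_univ]
  exact card_nsmul_le_sum _ _ _ fun a _ => h a a.2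

lemma pow_le_card_embedding_ne {V M : Type} [Finite V] [Finite M] (v : V) :
    (Nat.card V - Nat.card M) ^ Nat.card M ≤ Nat.card (M ↪ {u : V // u ≠ v}) := by
  classical
  have := Fintype.ofFinite V
  have := Fintype.ofFinite M
  have hV : 0 < Fintype.card V := Fintype.card_pos_iff.mpr ⟨v⟩
  simp only [Nat.card_eq_fintype_card, Fintype.card_embedding_eq]
  have h : Fintype.card {u : V // u ≠ v} = Fintype.card V - 1 := by
    simp
  rw [h]
  convert Nat.pow_sub_le_descFactorial (Fintype.card V - 1) (Fintype.card M) using 2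
  omega

lemma image_snoc_univ {V : Type} [DecidableEq V] {m : ℕ} (x : Fin m → V) (y : V) :
    univ.image (Fin.snoc x y : Fin (m + 1) → V) = insert y (univ.image x) := by
  ext z
  simp [Fin.exists_fin_succ', or_comm, eq_comm]

lemma image_snoc_erase_last {V : Type} [DecidableEq V] {m : ℕ} (x : Fin m → V) (y : V) :
    (univ.erase (Fin.last m)).image (Fin.snoc x y : Fin (m + 1) → V) = univ.image x := by
  ext z
  simp [Fin.exists_fin_succ']

/-- The edge `x` together with auxiliary vertices `w` and `v`: the `l`-th auxiliary vertex can
replace both the `l`-th and the `a l`-th vertex of the edge, `v` being the last one. -/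
def IsRootedEdge {V : Type} [DecidableEq V] {m : ℕ} (E : Finset (Finset V)) (v : V)
    (a : Fin (m + 1) → Fin (m + 1)) (x : Fin (m + 1) → V) (w : Fin m → V) : Prop :=
  univ.image x ∈ E ∧ ∀ l : Fin (m + 1),
    insert ((Fin.snoc w v : Fin (m + 1) → V) l) ((univ.erase l).image x) ∈ E ∧
    insert ((Fin.snoc w v : Fin (m + 1) → V) l) ((univ.erase (a l)).image x) ∈ E

lemma le_card_isRootedEdge {V : Type} [Fintype V] [DecidableEq V] {d : ℕ}
    {E : Finset (Finset V)} (hE : IsKGraph (d + 2) E) {γ : ℝ} (hγ : 0 < γ)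
    (hdeg : ∀ S : Finset V, S.card = d + 2 - 1 →
      (1 / 2 + γ) * (Fintype.card V : ℝ) ≤ (degS E S : ℝ))
    (hn : 2 * d ≤ Fintype.card V) (v : V) (a : Fin (d + 2) → Fin (d + 2))
    (ha : a (Fin.last (d + 1)) = Fin.last (d + 1)) :
    (1 / 2) ^ (d + 2) * (2 * γ) ^ (d + 1) *
      ((Nat.card V : ℝ) ^ (d + 2) * Nat.card (Fin (d + 1) → V)) ≤
      Nat.card {p : (Fin (d + 2) → V) × (Fin (d + 1) → V) // IsRootedEdge E v a p.1 p.2} := by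
  have hdeg' : ∀ S : Finset V, S.card + 1 = d + 2 →
      (Fintype.card V : ℝ) / 2 ≤ Nat.card {y // insert y S ∈ E} := by
    intro S hS
    have h₁ := hdeg S (by omega)
    have h₂ : (degS E S : ℝ) ≤ _ := Nat.cast_le.mpr (degS_le_card_insert hE hS)
    rw [Nat.card_eq_fintype_card, Fintype.card_subtype]
    have : 0 ≤ γ * (Fintype.card V : ℝ) := by positivity
    linarith
  set n : ℝ := ((Fintype.card V : ℕ) : ℝ) with hn_def
  have c₀ : (n / 2) ^ d ≤
      Nat.card {U : Fin d → V // Function.Injective U ∧ ∀ i, U i ≠ v} := by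
    have h₁ := pow_le_card_embedding_ne (M := Fin d) v
    have h₂ : Nat.card (Fin d ↪ {u : V // u ≠ v}) ≤
        Nat.card {U : Fin d → V // Function.Injective U ∧ ∀ i, U i ≠ v} := by
      refine Nat.card_le_card_of_injective (fun φ => ⟨fun i => φ i,
        Subtype.val_injective.comp φ.injective, fun i => (φ i).2⟩) fun φ ψ h => ?_
      ext i
      exact congrFun (Subtype.mk.inj h) i
    refine le_trans ?_ (Nat.cast_le.mpr (h₁.trans h₂))
    rw [Nat.card_fin, Nat.card_eq_fintype_card, Nat.cast_pow, Nat.cast_sub (by omega)]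
    have : 2 * (d : ℝ) ≤ n := by rw [hn_def]; exact_mod_cast hn
    exact pow_le_pow_left₀ (by positivity) (by linarith) _
  have c₁ := card_mul_le_card_extension
    (fun U : Fin d → V => Function.Injective U ∧ ∀ i, U i ≠ v)
    (fun U z => insert z (insert v (univ.image U)) ∈ E) (b := n / 2) (by
      rintro U ⟨hU, hv⟩
      apply hdeg'
      rw [card_insert_of_notMem (by simpa using hv), card_image_of_injective _ hU]
      simp)
  have c₂ := card_mul_le_card_extension
    (fun q : (Fin d → V) × V => (Function.Injective q.1 ∧ ∀ i, q.1 i ≠ v) ∧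
      insert q.2 (insert v (univ.image q.1)) ∈ E)
    (fun q y => insert y (univ.image (Fin.snoc q.1 q.2 : Fin (d + 1) → V)) ∈ E) (b := n / 2) (by
      rintro ⟨U, z⟩ ⟨_, hz⟩
      apply hdeg'
      rw [image_snoc_univ]
      have h₁ := hE _ hz
      dsimp only at h₁ ⊢
      rw [insert_comm] at h₁
      have h₂ := card_insert_le v (insert z (univ.image U))
      have h₃ := card_insert_le z (univ.image U)
      have h₄ := card_image_le (s := univ) (f := U)
      simp only [card_univ, Fintype.card_fin] at h₁ h₂ h₃ h₄
      omega)
  have c₃ := card_mul_le_card_extension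
    (fun q : ((Fin d → V) × V) × V => ((Function.Injective q.1.1 ∧ ∀ i, q.1.1 i ≠ v) ∧
      insert q.1.2 (insert v (univ.image q.1.1)) ∈ E) ∧
      insert q.2 (univ.image (Fin.snoc q.1.1 q.1.2 : Fin (d + 1) → V)) ∈ E)
    (fun q (w : Fin (d + 1) → V) => ∀ l : Fin (d + 1),
      insert (w l) ((univ.erase l.castSucc).image
        (Fin.snoc (Fin.snoc q.1.1 q.1.2 : Fin (d + 1) → V) q.2 : Fin (d + 2) → V)) ∈ E ∧
      insert (w l) ((univ.erase (a l.castSucc)).image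
        (Fin.snoc (Fin.snoc q.1.1 q.1.2 : Fin (d + 1) → V) q.2 : Fin (d + 2) → V)) ∈ E)
    (b := (2 * γ * n) ^ (d + 1)) (by
      rintro ⟨⟨U, z⟩, y⟩ ⟨_, hy⟩
      rw [← image_snoc_univ] at hy
      set x : Fin (d + 2) → V := Fin.snoc (Fin.snoc U z : Fin (d + 1) → V) y
      have hx : Function.Injective x := by
        rw [← Set.injOn_univ, ← coe_univ, ← card_image_iff, hE _ hy]
        simp
      have hcard : ∀ i, ((univ.erase i).image x).card + 1 = d + 2 := by
        intro i
        rw [card_image_of_injective _ hx, card_erase_of_mem (mem_univ _)]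
        simp
      have e : {w : Fin (d + 1) → V // ∀ l : Fin (d + 1),
          insert (w l) ((univ.erase l.castSucc).image x) ∈ E ∧
          insert (w l) ((univ.erase (a l.castSucc)).image x) ∈ E} ≃
          (∀ l : Fin (d + 1), {u : V // insert u ((univ.erase l.castSucc).image x) ∈ E ∧
            insert u ((univ.erase (a l.castSucc)).image x) ∈ E}) :=
        Equiv.subtypePiEquivPi
          (p := fun l u => insert u ((univ.erase (Fin.castSucc l)).image x) ∈ E ∧
            insert u ((univ.erase (a l.castSucc)).image x) ∈ E)
      rw [Nat.card_congr e, Nat.card_pi, Nat.cast_prod]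
      calc (2 * γ * n) ^ (d + 1) = ∏ _l : Fin (d + 1), 2 * γ * n := by simp
        _ ≤ _ := prod_le_prod (fun _ _ => by positivity) fun l _ => by
          rw [Nat.card_eq_fintype_card, Fintype.card_subtype]
          exact two_mul_le_card_common_insert hE hdeg (hcard _) (hcard _))
  refine le_trans ?_ (c₃.trans (Nat.cast_le.mpr ?_))
  · calc _ = (n / 2) ^ d * (n / 2) * (n / 2) * (2 * γ * n) ^ (d + 1) := by
          rw [Nat.card_fun, Nat.card_fin, Nat.card_eq_fintype_card (α := V), Nat.cast_pow, ← hn_def]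
          ring
      _ ≤ _ := by
          gcongr
          refine le_trans ?_ c₂
          gcongr
          refine le_trans ?_ c₁
          gcongr
  · refine Nat.card_le_card_of_injective (fun p => ⟨((Fin.snoc (Fin.snoc p.1.1.1.1 p.1.1.1.2 :
      Fin (d + 1) → V) p.1.1.2 : Fin (d + 2) → V), p.1.2), ?_, ?_⟩) ?_
    · rw [image_snoc_univ]
      exact p.2.1.2
    · intro l
      refine Fin.lastCases ?_ (fun l => ?_) l
      · rw [ha, image_snoc_erase_last, image_snoc_univ, Fin.snoc_last, and_self, insert_comm]
        exact p.2.1.1.2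
      · rw [Fin.snoc_castSucc]
        exact p.2.2 l
    · rintro ⟨⟨⟨⟨U, z⟩, y⟩, w⟩, _⟩ ⟨⟨⟨⟨U', z'⟩, y'⟩, w'⟩, _⟩ h
      obtain ⟨h, rfl⟩ := Prod.mk.inj (Subtype.mk.inj h)
      obtain ⟨h, rfl⟩ := (Fin.snoc_inj (α := fun _ => V)).mp h
      obtain ⟨rfl, rfl⟩ := (Fin.snoc_inj (α := fun _ => V)).mp h
      simp

/-- for `k ≥ 2` and `s ≥ 2k²`, every `k`-graph on `n ≥ n₀(k,s,γ)` vertices with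
minimum codegree at least `(1/2 + γ)n` has a `C_s^k`-covering. -/
theorem covering_threshold_upper (k s : ℕ) (hk : 2 ≤ k) (hs : 2 * k ^ 2 ≤ s)
    (γ : ℝ) (hγ : 0 < γ) :
    ∃ n₀ : ℕ, ∀ (V : Type) [Fintype V] [DecidableEq V] (E : Finset (Finset V)),
      IsKGraph k E → n₀ ≤ Fintype.card V →
      (∀ S : Finset V, S.card = k - 1 →
        (1 / 2 + γ) * (Fintype.card V : ℝ) ≤ (degS E S : ℝ)) →
      HasCsCovering k s E := by
  obtain ⟨d, rfl⟩ : ∃ d, k = d + 2 := ⟨k - 2, by omega⟩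
  obtain ⟨t, rfl⟩ : ∃ t, s = t + 1 := ⟨s - 1, by have : 0 < (d + 2) ^ 2 := by positivity
                                                 omega⟩
  set c : ℝ := ((1 / 2) ^ (d + 2) * (2 * γ) ^ (d + 1)) ^ ((t + 1) ^ (d + 2)) with hc
  have hc0 : 0 < c := by positivity
  set m : ℕ := (d + 2) * (t + 1) + (d + 1) with hm
  obtain ⟨N, hN⟩ := exists_nat_gt ((m : ℝ) ^ 2 / c)
  refine ⟨N + 2 * m, fun V _ _ E hE hn hdeg v => ?_⟩
  set π : Equiv.Perm (Fin (d + 2)) := Equiv.addLeft (Fin.ofNat (d + 2) (t + 1)) with hπ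
  have hlast : sortStep π (d + 1) (Fin.last (d + 1)) = Fin.last (d + 1) := by
    by_contra h
    have h₁ : (sortStep π (d + 1) (Fin.last (d + 1)) : ℕ) < d + 1 :=
      Fin.val_lt_last h
    have h₂ := sortStep_of_lt π (d + 1) _ h₁
    exact h ((sortStep π (d + 1)).injective h₂)
  have h₁ := card_blowup t (d + 2) (IsRootedEdge E v fun l => sortStep π l l)
    (by positivity) (le_card_isRootedEdge hE hγ hdeg (by nlinarith) v _ hlast)
  rw [← hc] at h₁
  have h₂ := pow_le_card_embedding_ne (M := (Fin (d + 2) × Fin (t + 1)) ⊕ Fin (d + 1)) v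
  have hM : Nat.card ((Fin (d + 2) × Fin (t + 1)) ⊕ Fin (d + 1)) = m := by
    simp [hm]
  rw [hM, Nat.card_eq_fintype_card] at h₂
  set n := Fintype.card V
  have hV : Nat.card V = n := Nat.card_eq_fintype_card
  have hn0 : (0 : ℝ) < n := Nat.cast_pos.mpr (Fintype.card_pos_iff.mpr ⟨v⟩)
  have hmn : m ≤ n := by omega
  have h₃ : (n : ℝ) ^ m * (1 - m ^ 2 / n) ≤ ((n - m : ℕ) : ℝ) ^ m := by
    have hb := one_add_mul_le_pow (a := -(m / n : ℝ)) (by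
      have : (m / n : ℝ) ≤ 1 := (div_le_one hn0).mpr (by exact_mod_cast hmn)
      linarith) m
    calc (n : ℝ) ^ m * (1 - m ^ 2 / n) = n ^ m * (1 + m * -(m / n)) := by ring
      _ ≤ n ^ m * (1 + -(m / n)) ^ m := by gcongr
      _ = _ := by
        rw [← mul_pow, Nat.cast_sub hmn]
        congr 1
        field_simp
        ring
  have h₄ : (m : ℝ) ^ 2 / n < c := by
    rw [div_lt_iff₀ hc0] at hN
    rw [div_lt_iff₀ hn0]
    have : (N : ℝ) ≤ n := by exact_mod_cast (by omega : N ≤ n)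
    nlinarith
  set T := (Fin (d + 2) → Fin (t + 1) → V) × (Fin (d + 1) → V)
  have hT : (Nat.card T : ℝ) = n ^ m := by
    simp only [T, Nat.card_prod, Nat.card_fun, Nat.card_fin, hV, hm]
    push_cast
    ring
  set φ : ((Fin (d + 2) × Fin (t + 1)) ⊕ Fin (d + 1) ↪ {u : V // u ≠ v}) → T :=
    fun f => (fun i j => f (Sum.inl (i, j)), fun l => f (Sum.inr l)) with hφ
  have hφ_inj : Function.Injective φ := by
    intro f f' h
    have h := Prod.mk.inj h
    ext (⟨i, j⟩ | l)
    · exact congrFun (congrFun h.1 i) j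
    · exact congrFun h.2 l
  obtain ⟨f, hf⟩ : ∃ f, ∀ g : Fin (d + 2) → Fin (t + 1),
      IsRootedEdge E v (fun l => sortStep π l l) (fun i => (φ f).1 i (g i)) (φ f).2 := by
    by_contra! hcon
    have h₅ : Nat.card ({p : T // ∀ g : Fin (d + 2) → Fin (t + 1),
        IsRootedEdge E v (fun l => sortStep π l l) (fun i => p.1 i (g i)) p.2} ⊕
        ((Fin (d + 2) × Fin (t + 1)) ⊕ Fin (d + 1) ↪ {u : V // u ≠ v})) ≤ Nat.card T := by
      refine Nat.card_le_card_of_injective (Sum.elim Subtype.val φ)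
        (Subtype.val_injective.sumElim hφ_inj fun p f h => ?_)
      obtain ⟨g, hg⟩ := hcon f
      exact hg (h ▸ p.2 g)
    rw [Nat.card_sum] at h₅
    have h₆ : ((_ + _ : ℕ) : ℝ) ≤ _ := Nat.cast_le.mpr h₅
    have h₇ : (((n - m) ^ m : ℕ) : ℝ) ≤ _ := Nat.cast_le.mpr h₂
    rw [hT] at h₆
    push_cast at h₆ h₇
    have h₈ : c * (n : ℝ) ^ m ≤ _ := le_trans (le_of_eq (by
      simp only [Nat.card_fun, Nat.card_fin, hV, hm]
      push_cast
      ring)) h₁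
    have h₉ : (0 : ℝ) < (n : ℝ) ^ m := by positivity
    have h₁₀ : (n : ℝ) ^ m * (m ^ 2 / n) < n ^ m * c := by gcongr
    linarith
  have hw : Function.Injective (Fin.snoc (φ f).2 v : Fin (d + 2) → V) := by
    rw [Fin.snoc_injective_iff]
    refine ⟨Subtype.val_injective.comp (f.injective.comp Sum.inr_injective), ?_⟩
    rintro ⟨l, hl⟩
    exact (f (Sum.inr l)).2 hl
  obtain ⟨C, hC⟩ := exists_isTightCycleList_of_blowup (by omega) hs π
    (fun j => by simp [hπ, Fin.val_add]) (φ f).1 (Fin.snoc (φ f).2 v : Fin (d + 2) → V)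
    (Function.Injective.sumElim
      (Subtype.val_injective.comp (f.injective.comp Sum.inl_injective)) hw (by
        rintro ⟨i, j⟩ l
        refine Fin.lastCases ?_ (fun l => ?_) l
        · rw [Fin.snoc_last]
          exact (f (Sum.inl (i, j))).2
        · rw [Fin.snoc_castSucc]
          intro h
          exact Sum.inl_ne_inr (f.injective (Subtype.val_injective h))))
    (fun g => (hf g).1) (fun g => (hf g).2)
  refine ⟨C, hC.1, hC.2.1, ?_⟩
  have := hC.2.2
  rwa [show (⟨d + 2 - 1, by omega⟩ : Fin (d + 2)) = Fin.last (d + 1) from rfl,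
    Fin.snoc_last] at this
end

section
/- Let 3 ≤ k < s be integers such that the pair (k,s) is admissible. Then for every n ≥ k there exists a k-graph H on n vertices with δ_{k−1}(H) ≥ ⌊n/2⌋ − k + 1 that does not have a C_s^k-covering; in particular c_{k−1}(n, C_s^k) ≥ ⌊n/2⌋ − k + 1. Moreover, if k is even, then there exists such an H on n vertices with δ_{k−1}(H) ≥ ⌊n/2⌋ − k + 1 that contains no copy of C_s^k at all; in particular ex_{k−1}(n, C_s^k) ≥ ⌊n/2⌋ − k + 1. -/
set_option autoImplicit false

open Finset

/-- The set of all `k`-sets meeting `B` in an odd number of vertices. -/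
def oddEdges {V : Type} [Fintype V] [DecidableEq V] (k : ℕ) (B : Finset V) :
    Finset (Finset V) :=
  (univ.powersetCard k).filter fun e => Odd (e ∩ B).card

theorem isKGraph_oddEdges {V : Type} [Fintype V] [DecidableEq V] (k : ℕ) (B : Finset V) :
    IsKGraph k (oddEdges k B) := by
  intro e he
  exact (mem_powersetCard.1 (mem_filter.1 he).1).2

theorem card_sdiff_le_degS_oddEdges {V : Type} [Fintype V] [DecidableEq V] {k : ℕ} (hk : 1 ≤ k)
    {B S X : Finset V} (hS : S.card = k - 1)
    (hX : ∀ x ∈ X, x ∉ S → Odd (insert x S ∩ B).card) :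
    (X \ S).card ≤ degS (oddEdges k B) S := by
  refine card_le_card_of_injOn (fun x => insert x S) ?_ ?_
  · intro x hx
    obtain ⟨hxX, hxS⟩ := mem_sdiff.1 (mem_coe.1 hx)
    simp only [oddEdges, coe_filter, mem_filter, mem_powersetCard, Set.mem_ofPred_eq]
    refine ⟨⟨⟨subset_univ _, ?_⟩, hX x hxX hxS⟩, subset_insert _ _⟩
    rw [card_insert_of_notMem hxS]
    omega
  · intro x hx y hy hxy
    have hxS := (mem_sdiff.1 (mem_coe.1 hx)).2
    have : x ∈ insert y S := by
      rw [← show insert x S = insert y S from hxy]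
      exact mem_insert_self _ _
    exact (mem_insert.1 this).resolve_right hxS

theorem le_degS_oddEdges {V : Type} [Fintype V] [DecidableEq V] {k m : ℕ} (hk : 1 ≤ k)
    {B S : Finset V} (hB : m ≤ B.card) (hB' : m ≤ Bᶜ.card) (hS : S.card = k - 1) :
    m ≤ degS (oddEdges k B) S + (k - 1) := by
  rcases Nat.even_or_odd (S ∩ B).card with h | h
  · have h1 := card_sdiff_le_degS_oddEdges (X := B) (B := B) hk hS (by
      intro x hx hxS
      rw [insert_inter_of_mem hx, card_insert_of_notMem (by simp [hxS])]
      exact h.add_one)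
    have := le_card_sdiff S B
    omega
  · have h1 := card_sdiff_le_degS_oddEdges (X := Bᶜ) (B := B) hk hS (by
      intro x hx hxS
      rwa [insert_inter_of_notMem (mem_compl.1 hx)])
    have := le_card_sdiff S Bᶜ
    omega

/-- The windows of a tight cycle of the odd-intersection hypergraph, read off from a periodic
indicator sequence. -/
theorem IsTightCycleList.odd_window {V : Type} [Fintype V] [DecidableEq V] {k : ℕ}
    {B : Finset V} {C : List V} (hC : IsTightCycleList k (oddEdges k B) C)
    (hk : k < C.length) (i : ℕ) :
    Odd (∑ j ∈ range k, if C[(i + j) % C.length]'(Nat.mod_lt _ (by omega)) ∈ B then 1 else 0) := by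
  have hs : 0 < C.length := by omega
  have hi : i % C.length < C.length := Nat.mod_lt _ hs
  have hwin : ((C ++ C).drop (i % C.length)).take k =
      (List.range k).map fun j => C[(i + j) % C.length]'(Nat.mod_lt _ hs) := by
    refine List.ext_getElem ?_ ?_
    · simp
      omega
    · intro j h1 h2
      have hj : j < k := by simpa using h2
      simp only [List.getElem_take, List.getElem_drop, List.getElem_map, List.getElem_range,
        List.getElem_append]
      have hmod : (i + j) % C.length = (i % C.length + j) % C.length := by
        rw [Nat.mod_add_mod]
      split_ifs with h
      · congr 1
        rw [hmod, Nat.mod_eq_of_lt h]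
      · congr 1
        rw [hmod, Nat.mod_eq_sub_mod (a := i % C.length + j) (by omega),
          Nat.mod_eq_of_lt (a := i % C.length + j - C.length) (by omega)]
  have hnd : ((List.range k).map fun j => C[(i + j) % C.length]'(Nat.mod_lt _ hs)).Nodup := by
    refine List.Nodup.map_on ?_ List.nodup_range
    intro x hx y hy hxy
    rw [List.mem_range] at hx hy
    have hmod : i + x ≡ i + y [MOD C.length] := (hC.1.getElem_inj_iff).1 hxy
    exact Nat.ModEq.eq_of_lt_of_lt hmod.add_left_cancel' (by omega) (by omega)
  have hodd := (mem_filter.1 (hC.2 _ hi)).2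
  rw [hwin, ← filter_mem_eq_inter, card_filter, List.sum_toFinset _ hnd, List.map_map] at hodd
  rwa [← List.sum_toFinset _ List.nodup_range, List.toFinset_range] at hodd

theorem sum_range_mul_of_periodic {g : ℕ → ℕ} {s : ℕ} (hg : ∀ i, g (i + s) = g i) (q : ℕ) :
    ∑ m ∈ range (q * s), g m = q * ∑ m ∈ range s, g m := by
  have hg' : ∀ q i, g (q * s + i) = g i := by
    intro q i
    induction q with
    | zero => simp
    | succ q ih => rw [← ih, ← hg (q * s + i)]; congr 1; ring
  induction q with
  | zero => simp
  | succ q ih =>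
    rw [Nat.add_one_mul, sum_range_add, ih, Nat.add_one_mul]
    simp [hg']

/-- If all windows of length `k` of an `s`-periodic sequence have odd sum, then
`k / gcd k s` is odd. -/
theorem not_even_div_gcd_of_odd_windows {g : ℕ → ℕ} {k s : ℕ} (hs : 0 < s)
    (hg : ∀ i, g (i + s) = g i) (hodd : ∀ i, Odd (∑ j ∈ range k, g (i + j))) :
    ¬ Even (k / Nat.gcd k s) := by
  intro heven
  have hd : 0 < Nat.gcd k s := Nat.gcd_pos_of_pos_right _ hs
  have hcop : Nat.Coprime (k / Nat.gcd k s) (s / Nat.gcd k s) := Nat.coprime_div_gcd_div_gcd hd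
  have hodd_s : Odd (s / Nat.gcd k s) := by
    rw [← Nat.not_even_iff_odd]
    intro h
    exact Nat.not_coprime_of_dvd_of_dvd one_lt_two heven.two_dvd h.two_dvd hcop
  have hwin : ∀ q, (∑ m ∈ range (q * k), g m) % 2 = q % 2 := by
    intro q
    induction q with
    | zero => simp
    | succ q ih =>
      have := Nat.odd_iff.1 (hodd (q * k))
      rw [Nat.add_one_mul, sum_range_add]
      omega
  have hcomm : s / Nat.gcd k s * k = k / Nat.gcd k s * s := by
    rw [← Nat.mul_div_right_comm (Nat.gcd_dvd_right k s),
      ← Nat.mul_div_right_comm (Nat.gcd_dvd_left k s), mul_comm]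
  have h := hwin (s / Nat.gcd k s)
  rw [hcomm, sum_range_mul_of_periodic hg, Nat.odd_iff.1 hodd_s,
    Nat.even_iff.1 (heven.mul_right _)] at h
  omega

theorem not_hasCsCopy_oddEdges {V : Type} [Fintype V] [DecidableEq V] {k s : ℕ} (hks : k < s)
    (h : Even (k / Nat.gcd k s)) (B : Finset V) : ¬ HasCsCopy k s (oddEdges k B) := by
  rintro ⟨C, rfl, hC⟩
  refine not_even_div_gcd_of_odd_windows (by omega)
    (g := fun m => if C[m % C.length]'(Nat.mod_lt _ (by omega)) ∈ B then 1 else 0) ?_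
    (fun i => hC.odd_window hks i) h
  intro i
  simp

/-- If `k` and `s` are coprime, then all vertices of a tight cycle of the odd-intersection
hypergraph lie in `B`. -/
theorem IsTightCycleList.mem_of_coprime {V : Type} [Fintype V] [DecidableEq V] {k : ℕ}
    {B : Finset V} {C : List V} (hC : IsTightCycleList k (oddEdges k B) C)
    (hk : k < C.length) (hcop : Nat.gcd k C.length = 1) {v : V} (hv : v ∈ C) : v ∈ B := by
  have hs : 0 < C.length := by omega
  set g : ℕ → ℕ := fun m => if C[m % C.length]'(Nat.mod_lt _ hs) ∈ B then 1 else 0 with hgdef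
  have hodd : ∀ i, Odd (∑ j ∈ range k, g (i + j)) := fun i => hC.odd_window hk i
  have hg2 : ∀ i, g i < 2 := by
    intro i
    simp only [hgdef]
    split_ifs <;> omega
  have hshift : ∀ i, g (i + k) = g i := by
    intro i
    have h0 := Nat.odd_iff.1 (hodd i)
    have h1 := Nat.odd_iff.1 (hodd (i + 1))
    have h2 := sum_range_succ (fun j => g (i + j)) k
    rw [sum_range_succ'] at h2
    have h3 : ∑ j ∈ range k, g (i + 1 + j) = ∑ j ∈ range k, g (i + (j + 1)) :=
      sum_congr rfl fun j _ => by congr 1; ring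
    have h4 := hg2 i
    have h5 := hg2 (i + k)
    simp only [add_zero] at h2
    omega
  have hshifts : ∀ q, g (q * k) = g 0 := by
    intro q
    induction q with
    | zero => simp
    | succ q ih => rw [Nat.add_one_mul, hshift, ih]
  have hconst : ∀ i, g i = g 0 := by
    intro i
    obtain ⟨y, hy⟩ := Nat.exists_mul_mod_eq_of_coprime i hcop hs.ne'
    have hmod : g i = g (y * k) := by
      simp only [hgdef]
      rw [mul_comm] at hy
      simp only [hy]
    rw [hmod, hshifts]
  have hg0 : g 0 ≠ 0 := by
    intro h
    have h1 := hodd 0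
    simp [hconst, h] at h1
  obtain ⟨i, hi, rfl⟩ := List.getElem_of_mem hv
  have h1 : g i ≠ 0 := by rwa [hconst]
  simp only [hgdef, Nat.mod_eq_of_lt hi] at h1
  by_contra hB
  exact h1 (if_neg hB)

theorem exists_le_card_and_le_card_compl (n : ℕ) :
    ∃ B : Finset (Fin n), n / 2 ≤ B.card ∧ n / 2 ≤ Bᶜ.card := by
  obtain ⟨B, -, hB⟩ := exists_subset_card_eq (s := (univ : Finset (Fin n))) (n := n / 2)
    (by simpa using Nat.div_le_self n 2)
  refine ⟨B, hB.ge, ?_⟩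
  rw [card_compl, hB, Fintype.card_fin]
  omega

/-- lower bounds for the covering and Turán codegree thresholds of tight cycles,
for admissible pairs `(k, s)`. -/
theorem covering_threshold_lower (k s : ℕ) (hk : 3 ≤ k) (hks : k < s)
    (hadm : AdmissiblePair k s) (n : ℕ) (hn : k ≤ n) :
    (∃ E : Finset (Finset (Fin n)), IsKGraph k E ∧ ¬ HasCsCovering k s E ∧
      ∀ S : Finset (Fin n), S.card = k - 1 →
        ((n / 2 : ℕ) : ℤ) - k + 1 ≤ (degS E S : ℤ)) ∧
    (Even k → ∃ E : Finset (Finset (Fin n)), IsKGraph k E ∧ ¬ HasCsCopy k s E ∧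
      ∀ S : Finset (Fin n), S.card = k - 1 →
        ((n / 2 : ℕ) : ℤ) - k + 1 ≤ (degS E S : ℤ)) := by
  obtain ⟨B, hB, hB'⟩ := exists_le_card_and_le_card_compl n
  have hdeg : ∀ S : Finset (Fin n), S.card = k - 1 →
      ((n / 2 : ℕ) : ℤ) - k + 1 ≤ (degS (oddEdges k B) S : ℤ) := by
    intro S hS
    have := le_degS_oddEdges (by omega) hB hB' hS
    omega
  refine ⟨⟨oddEdges k B, isKGraph_oddEdges k B, ?_, hdeg⟩, fun hkeven =>
    ⟨oddEdges k B, isKGraph_oddEdges k B, not_hasCsCopy_oddEdges hks ?_ B, hdeg⟩⟩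
  · intro hcov
    obtain ⟨v, hv⟩ : Bᶜ.Nonempty := card_pos.1 (by omega)
    obtain ⟨C, hCs, hC, hvC⟩ := hcov v
    rcases hadm with h | h
    · subst hCs
      exact mem_compl.1 hv (hC.mem_of_coprime hks h hvC)
    · exact not_hasCsCopy_oddEdges hks h B ⟨C, hCs, hC⟩
  · rcases hadm with h | h
    · simpa [h] using hkeven
    · exact h
end
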